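/- arXiv:0707.1745 — 2 statements merged into one kernel-verified Lean document; each statement's English description precedes it below -/
import Mathlib

section
/- Let 0<q<1 and v>-1. For all x, z ∈ ℝ_q^+ the kernel D_v satisfies ∫_0^∞ D_v(x,y,z) y^{2v+1} d_q y = 1. -/
open scoped BigOperators

noncomputable section

/-- Finite q-Pochhammer symbol `(a;q)_n = ∏_{i=0}^{n-1} (1 - a q^i)`. -/
def qPoch (a q : ℝ) (n : ℕ) : ℝ := ∏ i ∈ Finset.range n, (1 - a * q ^ i)

/-- Infinite q-Pochhammer symbol `(a;q)_∞ = ∏_{i=0}^{∞} (1 - a q^i)`. -/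
def qPochInf (a q : ℝ) : ℝ := ∏' i : ℕ, (1 - a * q ^ i)

/-- Normalized Hahn–Exton q-Bessel function `j_v(x,q²)`. -/
def jHE (q v x : ℝ) : ℝ :=
  ∑' n : ℕ, (-1 : ℝ) ^ n * q ^ (n * (n + 1)) * x ^ (2 * n) /
    (qPoch (q ^ 2) (q ^ 2) n * qPoch (q ^ (2 * v + 2)) (q ^ 2) n)

/-- Hahn–Exton q-Bessel function with base `p`:
`J_v(x,p) = (x^v/(p;p)_∞) Σ_{n} (-1)^n p^{n(n+1)/2} (p^{v+n+1};p)_∞ x^{2n}/(p;p)_n`.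
With `p = q²` this is `J_v(x,q²)`. -/
def JHE (p v x : ℝ) : ℝ :=
  (x ^ v / qPochInf p p) *
    ∑' n : ℕ, (-1 : ℝ) ^ n * p ^ (((n : ℝ) * ((n : ℝ) + 1)) / 2) *
      qPochInf (p ^ (v + (n : ℝ) + 1)) p * x ^ (2 * n) / qPoch p p n

/-- The constant `c_{q,v}`. -/
def cqv (q v : ℝ) : ℝ :=
  (1 / (1 - q)) * qPochInf (q ^ (2 * v + 2)) (q ^ 2) / qPochInf (q ^ 2) (q ^ 2)

/-- Jackson q-integral on `[0,∞)`: `∫_0^∞ f(x) d_q x = (1-q) Σ_{n∈ℤ} q^n f(q^n)`. -/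
def jackson (q : ℝ) (f : ℝ → ℝ) : ℝ := (1 - q) * ∑' n : ℤ, q ^ n * f (q ^ n)

/-- The q-lattice `ℝ_q^+ = {q^n : n ∈ ℤ}`. -/
def Rq (q : ℝ) : Set ℝ := {x | ∃ n : ℤ, x = q ^ n}

/-- Membership in `L_{q,1,v}`: the Jackson integral `∫_0^∞ |f(x)| x^{2v+1} d_q x`
converges (absolutely). -/
def memL1 (q v : ℝ) (f : ℝ → ℝ) : Prop :=
  Summable fun n : ℤ => q ^ n * |f (q ^ n)| * (q ^ n) ^ (2 * v + 1 : ℝ)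

/-- q-Bessel Fourier transform `F_{q,v}`. -/
def qFourier (q v : ℝ) (f : ℝ → ℝ) (x : ℝ) : ℝ :=
  cqv q v * jackson q fun t => f t * jHE q v (x * t) * t ^ (2 * v + 1 : ℝ)

/-- q-translation operator `T_{q,x}^v`. -/
def qTrans (q v x : ℝ) (f : ℝ → ℝ) (y : ℝ) : ℝ :=
  cqv q v * jackson q fun t =>
    qFourier q v f t * jHE q v (x * t) * jHE q v (y * t) * t ^ (2 * v + 1 : ℝ)

/-- The kernel `D_v(x,y,z)`. -/
def Dker (q v x y z : ℝ) : ℝ :=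
  (cqv q v) ^ 2 * jackson q fun t =>
    jHE q v (x * t) * jHE q v (y * t) * jHE q v (z * t) * t ^ (2 * v + 1 : ℝ)

/-- Positivity of the q-translation operator `T_{q,x}^v`. -/
def IsPosT (q v x : ℝ) : Prop :=
  ∀ f : ℝ → ℝ, memL1 q v f → (∀ y ∈ Rq q, 0 ≤ f y) → ∀ y ∈ Rq q, 0 ≤ qTrans q v x f y

/-- The positivity domain `Q_v`. -/
def Qset (v : ℝ) : Set ℝ :=
  {q | q ∈ Set.Ioo (0 : ℝ) 1 ∧ ∀ x ∈ Rq q, IsPosT q v x}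

/-- The kernel `E_{v,x}(q^m,q^z,q^k)`. -/
def Ekern (q v x : ℝ) (m z k : ℤ) : ℝ :=
  (1 / ((1 - q) ^ 2 * cqv q v * cqv q (x - v))) *
    q ^ (-(k : ℝ) * (x + 2) - (m : ℝ) * v - (z : ℝ) * (x - v)) *
    JHE (q ^ 2) ((z : ℝ) - (k : ℝ)) (q ^ (x - v + (m : ℝ) - (k : ℝ))) *
    JHE (q ^ 2) (v + (z : ℝ) - (k : ℝ)) (q ^ ((m : ℝ) - (k : ℝ)))

/-- The function `q ↦ ₁φ₁(0;q;q,q) = Σ_{n} (-1)^n q^{n(n+1)/2} q^n /((q;q)_n)²`. -/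
def phiQ (q : ℝ) : ℝ :=
  ∑' n : ℕ, (-1 : ℝ) ^ n * q ^ (((n : ℝ) * ((n : ℝ) + 1)) / 2) * q ^ n / (qPoch q q n) ^ 2

open Filter Topology

lemma summable_mul_pow {p : ℝ} (hp0 : 0 < p) (hp1 : p < 1) (x : ℝ) :
    Summable fun i : ℕ => ‖-(x * p ^ i)‖ := by
  simpa [abs_mul, abs_of_pos hp0] using
    (summable_geometric_of_lt_one hp0.le hp1).mul_left |x|

lemma multipliable_one_sub_mul_pow {p : ℝ} (hp0 : 0 < p) (hp1 : p < 1) (x : ℝ) :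
    Multipliable fun i : ℕ => 1 - x * p ^ i := by
  simpa [sub_eq_add_neg] using multipliable_one_add_of_summable (summable_mul_pow hp0 hp1 x)

lemma tendsto_qPoch {p : ℝ} (hp0 : 0 < p) (hp1 : p < 1) (x : ℝ) :
    Tendsto (qPoch x p) atTop (𝓝 (qPochInf x p)) :=
  (multipliable_one_sub_mul_pow hp0 hp1 x).tendsto_prod_tprod_nat

lemma qPoch_succ (x p : ℝ) (n : ℕ) : qPoch x p (n + 1) = qPoch x p n * (1 - x * p ^ n) :=
  Finset.prod_range_succ _ _

lemma qPoch_add (x p : ℝ) (m n : ℕ) :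
    qPoch x p (m + n) = qPoch x p m * qPoch (x * p ^ m) p n := by
  simp only [qPoch, Finset.prod_range_add, pow_add, mul_assoc]

lemma qPochInf_eq_qPoch_mul {p : ℝ} (hp0 : 0 < p) (hp1 : p < 1) (x : ℝ) (n : ℕ) :
    qPochInf x p = qPoch x p n * qPochInf (x * p ^ n) p := by
  refine tendsto_nhds_unique
    ((tendsto_qPoch hp0 hp1 x).comp (tendsto_add_atTop_nat n)) ?_
  refine ((tendsto_qPoch hp0 hp1 (x * p ^ n)).const_mul (qPoch x p n)).congr fun k => ?_
  simp [← qPoch_add, add_comm]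

lemma mul_pow_lt_one {p x : ℝ} (hp0 : 0 < p) (hp1 : p < 1) (hx : x < 1) (i : ℕ) :
    x * p ^ i < 1 := by
  have h0 : 0 < p ^ i := pow_pos hp0 i
  have h1 : p ^ i ≤ 1 := pow_le_one₀ hp0.le hp1.le
  nlinarith

lemma qPoch_pos {p x : ℝ} (hp0 : 0 < p) (hp1 : p < 1) (hx : x < 1) (n : ℕ) :
    0 < qPoch x p n :=
  Finset.prod_pos fun i _ => sub_pos.2 (mul_pow_lt_one hp0 hp1 hx i)

lemma qPochInf_ne_zero {p x : ℝ} (hp0 : 0 < p) (hp1 : p < 1) (hx : x < 1) :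
    qPochInf x p ≠ 0 := by
  have h := tprod_one_add_ne_zero_of_summable (f := fun i : ℕ => -(x * p ^ i))
    (fun i => by have := mul_pow_lt_one hp0 hp1 hx i; linarith) (summable_mul_pow hp0 hp1 x)
  simpa [qPochInf, sub_eq_add_neg] using h

lemma abs_qPochInf_le_one {p x : ℝ} (hp0 : 0 < p) (hp1 : p < 1) (hx0 : 0 ≤ x) (hx : x ≤ 1) :
    |qPochInf x p| ≤ 1 := by
  refine le_of_tendsto (tendsto_qPoch hp0 hp1 x).abs (Eventually.of_forall fun n => ?_)
  rw [qPoch, Finset.abs_prod]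
  refine Finset.prod_le_one (fun _ _ => abs_nonneg _) fun i _ => ?_
  have h0 : 0 < p ^ i := pow_pos hp0 i
  have h1 : p ^ i ≤ 1 := pow_le_one₀ hp0.le hp1.le
  rw [abs_le]
  constructor <;> nlinarith

/-- The coefficients of Euler's expansion `(x;p)_∞ = ∑ eulerCoeff p m * x ^ m`. -/
def eulerCoeff (p : ℝ) (m : ℕ) : ℝ := (-1) ^ m * p ^ m.choose 2 / qPoch p p m

lemma eulerCoeff_zero (p : ℝ) : eulerCoeff p 0 = 1 := by simp [eulerCoeff, qPoch]

lemma one_sub_pow_mul_eulerCoeff_succ {p : ℝ} (hp0 : 0 < p) (hp1 : p < 1) (m : ℕ) :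
    (1 - p ^ (m + 1)) * eulerCoeff p (m + 1) = -(p ^ m * eulerCoeff p m) := by
  have h1 := (qPoch_pos hp0 hp1 hp1 m).ne'
  have h2 := (qPoch_pos hp0 hp1 hp1 (m + 1)).ne'
  rw [qPoch_succ, ← pow_succ'] at h2
  have h3 := right_ne_zero_of_mul h2
  rw [eulerCoeff, eulerCoeff, qPoch_succ, ← pow_succ', Nat.choose_succ_succ' m 1,
    Nat.choose_one_right]
  field_simp
  ring

lemma summable_eulerCoeff_mul_pow {p : ℝ} (hp0 : 0 < p) (hp1 : p < 1) (x : ℝ) :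
    Summable fun m => |eulerCoeff p m * x ^ m| := by
  have hlim : Tendsto (fun m : ℕ => p ^ m * |x| / (1 - p)) atTop (𝓝 0) := by
    simpa using ((tendsto_pow_atTop_nhds_zero_of_lt_one hp0.le hp1).mul_const |x|).div_const (1 - p)
  suffices h : ∀ᶠ m : ℕ in atTop, ‖eulerCoeff p (m + 1) * x ^ (m + 1)‖ ≤
      1 / 2 * ‖eulerCoeff p m * x ^ m‖ from
    (summable_of_ratio_norm_eventually_le (by norm_num) h).abs
  filter_upwards [hlim.eventually_le_const (show (0 : ℝ) < 1 / 2 by norm_num)] with m hm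
  have hpm : p ^ (m + 1) ≤ p := by
    simpa using pow_le_pow_of_le_one hp0.le hp1.le (Nat.le_add_left 1 m)
  have hpos : 0 < 1 - p ^ (m + 1) := by linarith
  have key : eulerCoeff p (m + 1) * x ^ (m + 1) =
      -(p ^ m * x / (1 - p ^ (m + 1))) * (eulerCoeff p m * x ^ m) := by
    have := one_sub_pow_mul_eulerCoeff_succ hp0 hp1 m
    rw [neg_mul, div_mul_eq_mul_div, ← neg_div, eq_div_iff hpos.ne', pow_succ x m]
    linear_combination x * x ^ m * this
  rw [key, norm_mul]
  refine mul_le_mul_of_nonneg_right (le_trans ?_ hm) (norm_nonneg _)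
  rw [norm_neg, norm_div, norm_mul, norm_pow, Real.norm_of_nonneg hp0.le,
    Real.norm_of_nonneg hpos.le, Real.norm_eq_abs]
  gcongr

/-- Euler's expansion of `(x;p)_∞`. -/
theorem tsum_eulerCoeff_mul_pow {p : ℝ} (hp0 : 0 < p) (hp1 : p < 1) (x : ℝ) :
    ∑' m, eulerCoeff p m * x ^ m = qPochInf x p := by
  set F : ℝ → ℝ := fun x => ∑' m, eulerCoeff p m * x ^ m with hF
  have hs : ∀ x, Summable fun m => eulerCoeff p m * x ^ m :=
    fun x => (summable_eulerCoeff_mul_pow hp0 hp1 x).of_abs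
  have hstep : ∀ x, F x = (1 - x) * F (x * p) := by
    intro x
    have h1 : F x - F (x * p) = -(x * F (x * p)) := by
      simp only [hF]
      rw [← (hs x).tsum_sub (hs _), ((hs x).sub (hs _)).tsum_eq_zero_add, ← tsum_mul_left,
        ← tsum_neg]
      simp only [pow_zero, sub_self, zero_add]
      refine tsum_congr fun m => ?_
      rw [mul_pow, mul_pow]
      linear_combination x ^ (m + 1) * one_sub_pow_mul_eulerCoeff_succ hp0 hp1 m
    linear_combination h1
  have hiter : ∀ n : ℕ, F x = qPoch x p n * F (x * p ^ n) := by
    intro n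
    induction n with
    | zero => simp [qPoch]
    | succ n ih => rw [ih, qPoch_succ, hstep (x * p ^ n), pow_succ]; ring_nf
  have hpow : Tendsto (fun n : ℕ => x * p ^ n) atTop (𝓝 0) := by
    simpa using (tendsto_pow_atTop_nhds_zero_of_lt_one hp0.le hp1).const_mul x
  have hlim : Tendsto (fun n : ℕ => F (x * p ^ n)) atTop (𝓝 1) := by
    have h0 : ∑' m, eulerCoeff p m * (0 : ℝ) ^ m = 1 := by
      rw [tsum_eq_single 0 fun m hm => by simp [hm]]
      simp [eulerCoeff_zero]
    rw [← h0]
    refine tendsto_tsum_of_dominated_convergence (summable_eulerCoeff_mul_pow hp0 hp1 x)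
      (fun m => (hpow.pow m).const_mul _) (Eventually.of_forall fun n m => ?_)
    rw [Real.norm_eq_abs, abs_mul, abs_mul, abs_pow, abs_pow, abs_mul, abs_of_pos (pow_pos hp0 n)]
    gcongr
    exact mul_le_of_le_one_right (abs_nonneg x) (pow_le_one₀ hp0.le hp1.le)
  have h := (tendsto_qPoch hp0 hp1 x).mul hlim
  rw [mul_one] at h
  exact tendsto_nhds_unique (tendsto_const_nhds.congr hiter) h

/-- The sequence `n ↦ (p^{n+1};p)_∞` on `ℤ`, which vanishes for negative `n`. -/
def qTail (p : ℝ) (n : ℤ) : ℝ := qPochInf (p ^ (n + 1)) p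

lemma qTail_of_neg {p : ℝ} (hp0 : 0 < p) {n : ℤ} (hn : n < 0) : qTail p n = 0 := by
  refine tprod_of_exists_eq_zero ⟨(-(n + 1)).toNat, ?_⟩
  rw [← zpow_natCast, Int.toNat_of_nonneg (by lia), ← zpow_add₀ hp0.ne']
  simp

lemma abs_qTail_le_one {p : ℝ} (hp0 : 0 < p) (hp1 : p < 1) (n : ℤ) : |qTail p n| ≤ 1 := by
  rcases lt_or_ge n 0 with hn | hn
  · simp [qTail_of_neg hp0 hn]
  · exact abs_qPochInf_le_one hp0 hp1 (zpow_pos hp0 _).le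
      (zpow_le_one₀ hp0 hp1.le (by lia))

lemma qTail_sub_one {p : ℝ} (hp0 : 0 < p) (hp1 : p < 1) (n : ℤ) :
    qTail p (n - 1) = (1 - p ^ n) * qTail p n := by
  rw [qTail, qTail, sub_add_cancel, qPochInf_eq_qPoch_mul hp0 hp1 _ 1, zpow_add_one₀ hp0.ne']
  simp [qPoch]

lemma qTail_zero (p : ℝ) : qTail p 0 = qPochInf p p := by simp [qTail]

lemma tendsto_qTail_natCast {p : ℝ} (hp0 : 0 < p) (hp1 : p < 1) :
    Tendsto (fun n : ℕ => qTail p n) atTop (𝓝 1) := by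
  have h0 := qPochInf_ne_zero hp0 hp1 hp1
  have h := (tendsto_const_nhds (x := qPochInf p p)).div (tendsto_qPoch hp0 hp1 p) h0
  rw [div_self h0] at h
  refine h.congr fun n => ?_
  rw [Pi.div_apply, div_eq_iff (qPoch_pos hp0 hp1 hp1 n).ne', qPochInf_eq_qPoch_mul hp0 hp1 p n,
    mul_comm, qTail, zpow_add_one₀ hp0.ne', zpow_natCast, mul_comm p]

lemma hasSum_int_of_neg_eq_zero {f : ℤ → ℝ} (hf : ∀ n < 0, f n = 0) {s : ℝ} :
    HasSum (fun n : ℕ => f n) s ↔ HasSum f s :=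
  Nat.cast_injective.hasSum_iff fun n hn => hf n <| by
    by_contra! h
    exact hn ⟨n.toNat, Int.toNat_of_nonneg h⟩

lemma summable_pow_mul_qTail {p a : ℝ} (hp0 : 0 < p) (hp1 : p < 1) (ha0 : 0 < a) (ha1 : a < 1) :
    Summable fun n : ℕ => a ^ n * qTail p n := by
  refine Summable.of_norm_bounded (summable_geometric_of_lt_one ha0.le ha1) fun n => ?_
  rw [norm_mul, norm_pow, Real.norm_of_nonneg ha0.le]
  exact mul_le_of_le_one_right (pow_nonneg ha0.le n) (abs_qTail_le_one hp0 hp1 n)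

lemma summable_zpow_mul_qTail {p a : ℝ} (hp0 : 0 < p) (hp1 : p < 1) (ha0 : 0 < a) (ha1 : a < 1) :
    Summable fun n : ℤ => |a ^ n * qTail p n| := by
  obtain ⟨s, h⟩ := (summable_pow_mul_qTail hp0 hp1 ha0 ha1).abs
  refine ⟨s, (hasSum_int_of_neg_eq_zero fun n hn => by simp [qTail_of_neg hp0 hn]).1 ?_⟩
  simpa using h

/-- Euler's expansion of `1 / (a;p)_∞`, in the form
`(a;p)_∞ ∑ aⁿ (p^{n+1};p)_∞ = (p;p)_∞`. -/
theorem tsum_zpow_mul_qTail {p a : ℝ} (hp0 : 0 < p) (hp1 : p < 1) (ha0 : 0 < a) (ha1 : a < 1) :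
    ∑' n : ℤ, a ^ n * qTail p n = qPochInf p p / qPochInf a p := by
  have hcast : ∑' n : ℤ, a ^ n * qTail p n = ∑' n : ℕ, a ^ n * qTail p n := by
    refine ((hasSum_int_of_neg_eq_zero (f := fun n : ℤ => a ^ n * qTail p n)
      fun n hn => by simp [qTail_of_neg hp0 hn]).1 ?_).tsum_eq
    simpa using (summable_pow_mul_qTail hp0 hp1 ha0 ha1).hasSum
  set R : ℝ → ℝ := fun a => ∑' n : ℕ, a ^ n * qTail p n with hR
  have hmem : ∀ n : ℕ, 0 < a * p ^ n ∧ a * p ^ n < 1 := fun n =>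
    ⟨by positivity, mul_pow_lt_one hp0 hp1 ha1 n⟩
  have hs : ∀ b : ℝ, 0 < b → b < 1 → Summable fun n : ℕ => b ^ n * qTail p n :=
    fun b h0 h1 => summable_pow_mul_qTail hp0 hp1 h0 h1
  have hstep : ∀ b, 0 < b → b < 1 → R (b * p) = (1 - b) * R b := by
    intro b h0 h1
    have hbp : b * p < 1 := by nlinarith
    have h1 : R b - R (b * p) = b * R b := by
      simp only [hR]
      rw [← (hs b h0 h1).tsum_sub (hs _ (by positivity) hbp),
        ((hs b h0 h1).sub (hs _ (by positivity) hbp)).tsum_eq_zero_add, ← tsum_mul_left]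
      simp only [pow_zero, sub_self, zero_add]
      refine tsum_congr fun n => ?_
      have : qTail p n = (1 - p ^ (n + 1)) * qTail p ((n + 1 : ℕ) : ℤ) := by
        have := qTail_sub_one hp0 hp1 ((n : ℤ) + 1)
        rw [add_sub_cancel_right] at this
        rw [this]
        norm_cast
      rw [this, mul_pow]
      ring
    linear_combination -h1
  have hiter : ∀ n : ℕ, R (a * p ^ n) = qPoch a p n * R a := by
    intro n
    induction n with
    | zero => simp [qPoch]
    | succ n ih =>
      rw [pow_succ, ← mul_assoc, hstep _ (hmem n).1 (hmem n).2, ih, qPoch_succ]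
      ring
  have hpow : Tendsto (fun n : ℕ => a * p ^ n) atTop (𝓝 0) := by
    simpa using (tendsto_pow_atTop_nhds_zero_of_lt_one hp0.le hp1).const_mul a
  have hlim : Tendsto (fun n : ℕ => R (a * p ^ n)) atTop (𝓝 (qPochInf p p)) := by
    have h0 : ∑' n : ℕ, (0 : ℝ) ^ n * qTail p n = qPochInf p p := by
      rw [tsum_eq_single 0 fun m hm => by simp [hm]]
      simp [qTail_zero]
    rw [← h0]
    refine tendsto_tsum_of_dominated_convergence (hs a ha0 ha1).abs
      (fun m => (hpow.pow m).mul_const _) (Eventually.of_forall fun n m => ?_)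
    rw [Real.norm_eq_abs, abs_mul, abs_mul, abs_pow, abs_pow, abs_of_pos (hmem n).1,
      abs_of_pos ha0]
    gcongr
    exact mul_le_of_le_one_right ha0.le (pow_le_one₀ hp0.le hp1.le)
  rw [hcast, eq_div_iff (qPochInf_ne_zero hp0 hp1 ha1), mul_comm]
  exact tendsto_nhds_unique
    (((tendsto_qPoch hp0 hp1 a).mul_const (R a)).congr fun n => (hiter n).symm) hlim

/-- The function `n ↦ (a;p)_∞ ₁φ₁(0;a;p,p^{n+1})` on `ℤ`, expanded in the tails `qTail`. -/
def besselInt (p a : ℝ) (k : ℤ) : ℝ := ∑' m : ℕ, eulerCoeff p m * a ^ m * qTail p (k + m)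

lemma abs_besselInt_term_le {p : ℝ} (hp0 : 0 < p) (hp1 : p < 1) (a : ℝ) (k : ℤ) (m : ℕ) :
    ‖eulerCoeff p m * a ^ m * qTail p (k + m)‖ ≤ |eulerCoeff p m * a ^ m| := by
  rw [norm_mul]
  exact mul_le_of_le_one_right (abs_nonneg _) (abs_qTail_le_one hp0 hp1 _)

lemma summable_besselInt {p : ℝ} (hp0 : 0 < p) (hp1 : p < 1) (a : ℝ) (k : ℤ) :
    Summable fun m : ℕ => eulerCoeff p m * a ^ m * qTail p (k + m) :=
  .of_norm_bounded (summable_eulerCoeff_mul_pow hp0 hp1 a) (abs_besselInt_term_le hp0 hp1 a k)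

lemma abs_besselInt_le {p : ℝ} (hp0 : 0 < p) (hp1 : p < 1) (a : ℝ) (k : ℤ) :
    |besselInt p a k| ≤ ∑' m, |eulerCoeff p m * a ^ m| :=
  tsum_of_norm_bounded (summable_eulerCoeff_mul_pow hp0 hp1 a).hasSum
    (abs_besselInt_term_le hp0 hp1 a k)

lemma tendsto_besselInt_natCast {p : ℝ} (hp0 : 0 < p) (hp1 : p < 1) (a : ℝ) (k : ℤ) :
    Tendsto (fun n : ℕ => besselInt p a (n + k)) atTop (𝓝 (qPochInf a p)) := by
  rw [← tsum_eulerCoeff_mul_pow hp0 hp1 a]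
  refine tendsto_tsum_of_dominated_convergence (summable_eulerCoeff_mul_pow hp0 hp1 a)
    (fun m => ?_) (Eventually.of_forall fun n m => abs_besselInt_term_le hp0 hp1 a _ m)
  have h : Tendsto (fun n : ℕ => ((n : ℤ) + k + m).toNat) atTop atTop :=
    tendsto_atTop.2 fun b => (eventually_ge_atTop (b + k.natAbs)).mono fun n hn => by lia
  have h2 := ((tendsto_qTail_natCast hp0 hp1).comp h).const_mul (eulerCoeff p m * a ^ m)
  rw [mul_one] at h2
  refine h2.congr' ((eventually_ge_atTop k.natAbs).mono fun n hn => ?_)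
  simp only [Function.comp_apply]
  rw [Int.toNat_of_nonneg (by lia)]

lemma tendsto_besselInt_neg_natCast {p : ℝ} (hp0 : 0 < p) (hp1 : p < 1) (a : ℝ) (k : ℤ) :
    Tendsto (fun n : ℕ => besselInt p a (-n + k)) atTop (𝓝 0) := by
  rw [← tsum_zero (β := ℕ)]
  refine tendsto_tsum_of_dominated_convergence (summable_eulerCoeff_mul_pow hp0 hp1 a)
    (fun m => ?_) (Eventually.of_forall fun n m => abs_besselInt_term_le hp0 hp1 a _ m)
  refine tendsto_const_nhds.congr'
    ((eventually_ge_atTop (k.natAbs + m + 1)).mono fun n hn => ?_)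
  simp only [qTail_of_neg hp0 (show -(n : ℤ) + k + m < 0 by lia), mul_zero]

/-- The shear `(k, m) ↦ (k + m, m)` of `ℤ × ℕ`. -/
def shearEquiv : ℤ × ℕ ≃ ℤ × ℕ where
  toFun x := (x.1 + x.2, x.2)
  invFun x := (x.1 - x.2, x.2)
  left_inv x := by simp
  right_inv x := by simp

lemma summable_mul_shear {r : ℤ → ℝ} {c : ℕ → ℝ} (hr : Summable fun n => |r n|)
    (hc : Summable fun m => |c m|) :
    Summable fun x : ℤ × ℕ => |c x.2 * r (x.1 + x.2)| := by
  have h := Summable.mul_of_nonneg hr hc (fun _ => abs_nonneg _) (fun _ => abs_nonneg _)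
  refine ((shearEquiv.summable_iff).2 h).congr fun x => ?_
  rw [abs_mul, mul_comm]
  rfl

lemma summable_besselInt_sub {p a : ℝ} (hp0 : 0 < p) (hp1 : p < 1) :
    Summable fun k : ℤ => |besselInt p a k - besselInt p a (k - 1)| := by
  have h := summable_mul_shear (summable_zpow_mul_qTail hp0 hp1 hp0 hp1)
    (summable_eulerCoeff_mul_pow hp0 hp1 a)
  refine Summable.abs (h.of_abs.prod.congr fun k => ?_)
  rw [besselInt, besselInt, ← (summable_besselInt hp0 hp1 a k).tsum_sub
    (summable_besselInt hp0 hp1 a (k - 1))]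
  refine tsum_congr fun m => ?_
  rw [sub_add_eq_add_sub, qTail_sub_one hp0 hp1]
  ring

lemma tsum_int_sub_sub_one {f : ℤ → ℝ} {A B : ℝ} (hs : Summable fun n => f n - f (n - 1))
    (hA : Tendsto (fun n : ℕ => f n) atTop (𝓝 A))
    (hB : Tendsto (fun n : ℕ => f (-n)) atTop (𝓝 B)) :
    ∑' n, (f n - f (n - 1)) = A - B := by
  have hinj : Function.Injective fun n : ℕ => -((n : ℤ) + 1) := fun m n h => by
    simp only at h
    lia
  have h1 : Summable fun n : ℕ => f n - f (n - 1) := hs.comp_injective Nat.cast_injective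
  have h2 : Summable fun n : ℕ => f (-(n + 1)) - f (-(n + 1) - 1) :=
    hs.comp_injective hinj
  rw [tsum_of_nat_of_neg_add_one (f := fun n => f n - f (n - 1)) h1 h2]
  have e1 : ∑' n : ℕ, (f n - f (n - 1)) = A - f (-1) := by
    have h := h1.hasSum.tendsto_sum_nat.comp (tendsto_add_atTop_nat 1)
    refine tendsto_nhds_unique h ?_
    refine (hA.sub_const (f (-1))).congr fun n => ?_
    have := Finset.sum_range_sub (fun n : ℕ => f (n - 1)) (n + 1)
    simpa using! this.symm
  have e2 : ∑' n : ℕ, (f (-(n + 1)) - f (-(n + 1) - 1)) = f (-1) - B := by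
    refine tendsto_nhds_unique h2.hasSum.tendsto_sum_nat ?_
    have h := (hB.comp (tendsto_add_atTop_nat 1)).const_sub (f (-1))
    refine h.congr fun n => ?_
    have := Finset.sum_range_sub' (fun n : ℕ => f (-(n + 1))) n
    simp only [Function.comp_apply, Nat.cast_add, Nat.cast_one, Nat.cast_zero, zero_add] at this ⊢
    rw [← this]
    refine Finset.sum_congr rfl fun i _ => ?_
    congr 2
  rw [e1, e2]
  ring

lemma tsum_eulerCoeff_mul {p : ℝ} (hp0 : 0 < p) (hp1 : p < 1) {f : ℕ → ℝ} {B : ℝ}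
    (hf : ∀ m, |f m| ≤ B) :
    ∑' m, eulerCoeff p m * f m = ∑' m, eulerCoeff p m * p ^ m * (f m - f (m + 1)) := by
  have hs : ∀ (x : ℝ) (g : ℕ → ℝ), (∀ m, |g m| ≤ B) →
      Summable fun m => eulerCoeff p m * x ^ m * g m := fun x g hg => by
    refine .of_norm_bounded ((summable_eulerCoeff_mul_pow hp0 hp1 x).mul_right B) fun m => ?_
    rw [norm_mul]
    exact mul_le_mul_of_nonneg_left (hg m) (abs_nonneg _)
  have h1 : Summable fun m => eulerCoeff p m * f m := by simpa using hs 1 f hf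
  have h2 := hs p f hf
  have h3 := hs p (fun m => f (m + 1)) fun m => hf (m + 1)
  simp only [mul_sub]
  rw [h2.tsum_sub h3, h1.tsum_eq_zero_add, h2.tsum_eq_zero_add, add_sub_assoc,
    ← ((summable_nat_add_iff 1).2 h2).tsum_sub h3]
  simp only [pow_zero, mul_one]
  congr 1
  refine tsum_congr fun m => ?_
  linear_combination f (m + 1) * one_sub_pow_mul_eulerCoeff_succ hp0 hp1 m

lemma zpow_mul_besselInt {p a : ℝ} (ha0 : 0 < a) (k : ℤ) :
    a ^ k * besselInt p a k =
      ∑' m : ℕ, eulerCoeff p m * (a ^ (k + m) * qTail p (k + m)) := by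
  rw [besselInt, ← tsum_mul_left]
  refine tsum_congr fun m => ?_
  rw [zpow_add₀ ha0.ne', zpow_natCast]
  ring

lemma tsum_zpow_mul_besselInt {p a : ℝ} (hp0 : 0 < p) (hp1 : p < 1) (ha0 : 0 < a) (ha1 : a < 1)
    {g : ℤ → ℝ} {B : ℝ} (hg : ∀ n, |g n| ≤ B) (y : ℤ) :
    a ^ y * ∑' k : ℤ, a ^ k * (g k * besselInt p a (y + k)) =
      ∑' n : ℤ, ∑' m : ℕ, a ^ n * qTail p n *
        (eulerCoeff p m * p ^ m * (g (n - m - y) - g (n - m - y - 1))) := by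
  set r : ℤ → ℝ := fun n => a ^ n * qTail p n with hr
  have hrs : Summable fun n => |r n| := summable_zpow_mul_qTail hp0 hp1 ha0 ha1
  have hes : Summable fun m => |eulerCoeff p m| := by
    simpa using summable_eulerCoeff_mul_pow hp0 hp1 1
  have hprod : Summable fun x : ℤ × ℕ => eulerCoeff p x.2 * r (x.1 + x.2) * g (x.1 - y) := by
    refine .of_norm_bounded ((summable_mul_shear hrs hes).mul_right B) fun x => ?_
    rw [norm_mul]
    exact mul_le_mul_of_nonneg_left (hg _) (abs_nonneg _)
  have hsymm : Summable fun x : ℤ × ℕ => eulerCoeff p x.2 * r x.1 * g (x.1 - x.2 - y) := by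
    refine ((shearEquiv.symm.summable_iff).2 hprod).congr fun x => ?_
    simp [shearEquiv]
  calc a ^ y * ∑' k : ℤ, a ^ k * (g k * besselInt p a (y + k))
      = ∑' k : ℤ, a ^ k * besselInt p a k * g (k - y) := by
        rw [← tsum_mul_left, ← (Equiv.addLeft y).tsum_eq fun k => a ^ k * besselInt p a k * g (k - y)]
        refine tsum_congr fun k => ?_
        simp only [Equiv.coe_addLeft, add_sub_cancel_left, zpow_add₀ ha0.ne']
        ring
    _ = ∑' k : ℤ, ∑' m : ℕ, eulerCoeff p m * r (k + m) * g (k - y) := by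
        simp only [zpow_mul_besselInt ha0, ← tsum_mul_right, hr]
    _ = ∑' x : ℤ × ℕ, eulerCoeff p x.2 * r (x.1 + x.2) * g (x.1 - y) := hprod.tsum_prod.symm
    _ = ∑' x : ℤ × ℕ, eulerCoeff p x.2 * r x.1 * g (x.1 - x.2 - y) := by
        rw [← shearEquiv.symm.tsum_eq]
        simp [shearEquiv]
    _ = ∑' n : ℤ, ∑' m : ℕ, eulerCoeff p m * r n * g (n - m - y) := hsymm.tsum_prod
    _ = _ := by
        refine tsum_congr fun n => ?_
        rw [tsum_mul_left]
        have h := tsum_eulerCoeff_mul hp0 hp1 (f := fun m : ℕ => g (n - m - y)) fun m => hg _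
        simp only [mul_right_comm _ (r n), tsum_mul_right]
        rw [h, mul_comm]
        congr 1
        refine tsum_congr fun m => ?_
        push_cast
        ring_nf

/-- The equivalence `(y, n, m) ↦ (n - m - y, n, m)` of `ℤ × ℤ × ℕ`. -/
def reflectShearEquiv : ℤ × ℤ × ℕ ≃ ℤ × ℤ × ℕ where
  toFun x := (x.2.1 - x.2.2 - x.1, x.2)
  invFun x := (x.2.1 - x.2.2 - x.1, x.2)
  left_inv x := by simp
  right_inv x := by simp

theorem tsum_tsum_zpow_mul_besselInt {p a : ℝ} (hp0 : 0 < p) (hp1 : p < 1) (ha0 : 0 < a)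
    (ha1 : a < 1) {g : ℤ → ℝ} {B : ℝ} (hg : ∀ n, |g n| ≤ B)
    (hd : Summable fun n => |g n - g (n - 1)|) :
    ∑' y : ℤ, a ^ y * ∑' k : ℤ, a ^ k * (g k * besselInt p a (y + k)) =
      (∑' n, (g n - g (n - 1))) * (qPochInf p p / qPochInf a p * qPochInf p p) := by
  simp only [tsum_zpow_mul_besselInt hp0 hp1 ha0 ha1 hg]
  rw [← tsum_zpow_mul_qTail hp0 hp1 ha0 ha1, ← tsum_eulerCoeff_mul_pow hp0 hp1 p]
  set r : ℤ → ℝ := fun n => a ^ n * qTail p n with hr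
  set T : ℕ → ℝ := fun m => eulerCoeff p m * p ^ m with hT
  set d : ℤ → ℝ := fun n => g n - g (n - 1) with hdd
  have hrs : Summable fun n => ‖r n‖ := summable_zpow_mul_qTail hp0 hp1 ha0 ha1
  have hTs : Summable fun m => ‖T m‖ := summable_eulerCoeff_mul_pow hp0 hp1 p
  have hrT : Summable fun x : ℤ × ℕ => ‖r x.1 * T x.2‖ := hrs.mul_norm hTs
  have hds : Summable fun n => ‖d n‖ := hd
  have hdrT : Summable fun x : ℤ × ℤ × ℕ => d x.1 * (r x.2.1 * T x.2.2) :=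
    (hds.mul_norm hrT).of_norm
  have hsh : Summable fun x : ℤ × ℤ × ℕ => r x.2.1 * (T x.2.2 * d (x.2.1 - x.2.2 - x.1)) := by
    refine ((reflectShearEquiv.summable_iff).2 hdrT).congr fun x => ?_
    simp only [reflectShearEquiv, Function.comp_apply, Equiv.coe_fn_mk]
    ring
  rw [tsum_mul_tsum_of_summable_norm hrs hTs, tsum_mul_tsum_of_summable_norm hds hrT,
    ← reflectShearEquiv.tsum_eq]
  calc _ = ∑' y : ℤ, ∑' x : ℤ × ℕ, r x.1 * (T x.2 * d (x.1 - x.2 - y)) :=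
        tsum_congr fun y => ((hsh.prod_factor y).tsum_prod).symm
    _ = ∑' x : ℤ × ℤ × ℕ, r x.2.1 * (T x.2.2 * d (x.2.1 - x.2.2 - x.1)) := hsh.tsum_prod.symm
    _ = _ := by
        refine tsum_congr fun x => ?_
        simp only [reflectShearEquiv, Equiv.coe_fn_mk]
        ring

lemma mul_succ_eq_two_mul_choose (n : ℕ) : n * (n + 1) = 2 * (n.choose 2 + n) := by
  induction n with
  | zero => rfl
  | succ n ih =>
    rw [Nat.choose_succ_succ' n 1, Nat.choose_one_right]
    linarith

lemma jHE_zpow {q v : ℝ} (hq0 : 0 < q) (hq1 : q < 1) (hv : -1 < v) (k : ℤ) :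
    jHE q v (q ^ k) =
      besselInt (q ^ 2) (q ^ (2 * v + 2)) k / qPochInf (q ^ (2 * v + 2)) (q ^ 2) := by
  have ha1 : q ^ (2 * v + 2) < 1 := Real.rpow_lt_one hq0.le hq1 (by linarith)
  set a := q ^ (2 * v + 2) with ha
  have hp0 : 0 < q ^ 2 := by positivity
  have hp1 : q ^ 2 < 1 := pow_lt_one₀ hq0.le hq1 two_ne_zero
  set p := q ^ 2 with hp
  have hainf := qPochInf_ne_zero hp0 hp1 ha1
  have hterm : ∀ n : ℕ, (-1 : ℝ) ^ n * q ^ (n * (n + 1)) * (q ^ k) ^ (2 * n) /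
      (qPoch p p n * qPoch a p n) =
        (∑' m : ℕ, eulerCoeff p n * (p ^ (k + 1)) ^ n *
          (eulerCoeff p m * (a * p ^ n) ^ m)) / qPochInf a p := by
    intro n
    have h1 := (qPoch_pos hp0 hp1 hp1 n).ne'
    have h2 := (qPoch_pos hp0 hp1 ha1 n).ne'
    have h3 := qPochInf_eq_qPoch_mul hp0 hp1 a n
    have h4 := right_ne_zero_of_mul (h3 ▸ hainf)
    have h6 : (q ^ k) ^ (2 * n) = (p ^ k) ^ n := by
      rw [pow_mul, hp, ← zpow_natCast (q ^ k) 2, ← zpow_natCast q 2, zpow_comm]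
    rw [tsum_mul_left, tsum_eulerCoeff_mul_pow hp0 hp1, h3, h6, mul_succ_eq_two_mul_choose,
      pow_mul, ← hp, eulerCoeff, zpow_add_one₀ hp0.ne']
    field_simp
    ring
  have hsum : Summable fun x : ℕ × ℕ => eulerCoeff p x.1 * (p ^ (k + 1)) ^ x.1 *
      (eulerCoeff p x.2 * (a * p ^ x.1) ^ x.2) := by
    have h1 : Summable fun n => ‖eulerCoeff p n * (p ^ (k + 1)) ^ n‖ :=
      summable_eulerCoeff_mul_pow hp0 hp1 _
    have h2 : Summable fun m => ‖eulerCoeff p m * a ^ m‖ := summable_eulerCoeff_mul_pow hp0 hp1 _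
    refine .of_norm_bounded (h1.mul_norm h2) fun x => ?_
    rw [norm_mul, norm_mul _ (_ * _), mul_pow, ← mul_assoc (eulerCoeff p x.2), norm_mul (_ * a ^ _)]
    refine mul_le_mul_of_nonneg_left (mul_le_of_le_one_right (norm_nonneg _) ?_) (norm_nonneg _)
    rw [← pow_mul, norm_pow, Real.norm_of_nonneg hp0.le]
    exact pow_le_one₀ hp0.le hp1.le
  simp only [jHE, ← hp, ← ha, hterm, tsum_div_const]
  congr 1
  rw [← Summable.tsum_comm (f := fun n m => eulerCoeff p n * (p ^ (k + 1)) ^ n *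
    (eulerCoeff p m * (a * p ^ n) ^ m)) hsum, besselInt]
  refine tsum_congr fun m => ?_
  rw [qTail, ← tsum_eulerCoeff_mul_pow hp0 hp1, ← tsum_mul_left]
  refine tsum_congr fun n => ?_
  rw [add_right_comm, zpow_add₀ hp0.ne' (k + 1), zpow_natCast]
  ring

lemma zpow_mul_zpow_rpow {q : ℝ} (hq0 : 0 < q) (s : ℝ) (n : ℤ) :
    q ^ n * (q ^ n) ^ (2 * s + 1) = (q ^ (2 * s + 2)) ^ n := by
  simp only [← Real.rpow_intCast, ← Real.rpow_mul hq0.le, ← Real.rpow_add hq0]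
  congr 1
  ring

lemma summable_mul_sub_mul {f g : ℤ → ℝ} {A B : ℝ} (hf : ∀ n, |f n| ≤ A) (hg : ∀ n, |g n| ≤ B)
    (hfs : Summable fun n => |f n - f (n - 1)|) (hgs : Summable fun n => |g n - g (n - 1)|) :
    Summable fun n => |f n * g n - f (n - 1) * g (n - 1)| := by
  refine Summable.of_norm_bounded ((hfs.mul_right B).add (hgs.mul_left A)) fun n => ?_
  rw [show f n * g n - f (n - 1) * g (n - 1) =
    (f n - f (n - 1)) * g n + f (n - 1) * (g n - g (n - 1)) by ring, norm_abs_eq_norm]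
  refine (norm_add_le _ _).trans ?_
  rw [norm_mul, norm_mul]
  exact add_le_add (mul_le_mul_of_nonneg_left (hg n) (abs_nonneg _))
    (mul_le_mul_of_nonneg_right (hf _) (abs_nonneg _))

/-- The double series evaluated by the total mass of the kernel `D_v`, before normalization. -/
theorem tsum_tsum_besselInt_mul {p a : ℝ} (hp0 : 0 < p) (hp1 : p < 1) (ha0 : 0 < a) (ha1 : a < 1)
    (i l : ℤ) :
    ∑' y : ℤ, a ^ y * ∑' k : ℤ,
        a ^ k * (besselInt p a (k + i) * besselInt p a (k + l) * besselInt p a (y + k)) =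
      qPochInf p p ^ 2 * qPochInf a p := by
  set M := ∑' m, |eulerCoeff p m * a ^ m|
  have hM : ∀ n, |besselInt p a n| ≤ M := abs_besselInt_le hp0 hp1 a
  have hM0 : 0 ≤ M := (abs_nonneg _).trans (hM 0)
  have hshift : ∀ j : ℤ, Summable fun n : ℤ =>
      |besselInt p a (n + j) - besselInt p a (n - 1 + j)| := fun j => by
    refine (((Equiv.addRight j).summable_iff).2
      (summable_besselInt_sub (a := a) hp0 hp1)).congr fun n => ?_
    simp [sub_add_eq_add_sub]
  have hd := summable_mul_sub_mul (f := fun n => besselInt p a (n + i))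
    (g := fun n => besselInt p a (n + l)) (fun n => hM _) (fun n => hM _) (hshift i) (hshift l)
  have hg : ∀ n : ℤ, |besselInt p a (n + i) * besselInt p a (n + l)| ≤ M * M := fun n => by
    rw [abs_mul]
    exact mul_le_mul (hM _) (hM _) (abs_nonneg _) hM0
  have htel := tsum_int_sub_sub_one (f := fun n => besselInt p a (n + i) * besselInt p a (n + l))
    hd.of_abs ((tendsto_besselInt_natCast hp0 hp1 a i).mul (tendsto_besselInt_natCast hp0 hp1 a l))
    ((tendsto_besselInt_neg_natCast hp0 hp1 a i).mul (tendsto_besselInt_neg_natCast hp0 hp1 a l))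
  have h := tsum_tsum_zpow_mul_besselInt hp0 hp1 ha0 ha1
    (g := fun n => besselInt p a (n + i) * besselInt p a (n + l)) hg hd
  rw [h, htel]
  have := qPochInf_ne_zero hp0 hp1 ha1
  field_simp
  ring

/-- the kernel `D_v` has total mass one. -/
theorem stmt7 (q v : ℝ) (hq0 : 0 < q) (hq1 : q < 1) (hv : -1 < v) :
    ∀ x ∈ Rq q, ∀ z ∈ Rq q,
      jackson q (fun y => Dker q v x y z * y ^ (2 * v + 1 : ℝ)) = 1 := by
  rintro _ ⟨i, rfl⟩ _ ⟨l, rfl⟩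
  have ha0 : 0 < q ^ (2 * v + 2) := Real.rpow_pos_of_pos hq0 _
  have ha1 : q ^ (2 * v + 2) < 1 := Real.rpow_lt_one hq0.le hq1 (by linarith)
  have hp0 : 0 < q ^ 2 := by positivity
  have hp1 : q ^ 2 < 1 := pow_lt_one₀ hq0.le hq1 two_ne_zero
  have hA := qPochInf_ne_zero hp0 hp1 ha1
  have hP := qPochInf_ne_zero hp0 hp1 hp1
  have hq : 1 - q ≠ 0 := by linarith
  have hinner : ∀ y : ℤ, q ^ y * (Dker q v (q ^ i) (q ^ y) (q ^ l) * (q ^ y) ^ (2 * v + 1)) =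
      (cqv q v) ^ 2 * (1 - q) / qPochInf (q ^ (2 * v + 2)) (q ^ 2) ^ 3 *
        ((q ^ (2 * v + 2)) ^ y * ∑' k : ℤ, (q ^ (2 * v + 2)) ^ k *
          (besselInt (q ^ 2) (q ^ (2 * v + 2)) (k + i) *
            besselInt (q ^ 2) (q ^ (2 * v + 2)) (k + l) *
            besselInt (q ^ 2) (q ^ (2 * v + 2)) (y + k))) := by
    intro y
    rw [mul_left_comm, zpow_mul_zpow_rpow hq0, Dker, jackson]
    have hk : ∀ k : ℤ, q ^ k * (jHE q v (q ^ i * q ^ k) * jHE q v (q ^ y * q ^ k) *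
        jHE q v (q ^ l * q ^ k) * (q ^ k) ^ (2 * v + 1)) =
          1 / qPochInf (q ^ (2 * v + 2)) (q ^ 2) ^ 3 * ((q ^ (2 * v + 2)) ^ k *
          (besselInt (q ^ 2) (q ^ (2 * v + 2)) (k + i) *
            besselInt (q ^ 2) (q ^ (2 * v + 2)) (k + l) *
            besselInt (q ^ 2) (q ^ (2 * v + 2)) (y + k))) := by
      intro k
      simp only [← zpow_add₀ hq0.ne', jHE_zpow hq0 hq1 hv]
      rw [mul_left_comm, zpow_mul_zpow_rpow hq0, add_comm i, add_comm l]
      field_simp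
    simp only [hk, tsum_mul_left]
    ring
  simp only [jackson, hinner, tsum_mul_left]
  rw [tsum_tsum_besselInt_mul hp0 hp1 ha0 ha1, cqv]
  generalize qPochInf (q ^ (2 * v + 2)) (q ^ 2) = A at hA ⊢
  field_simp
end
end

section
/- Let 0<q<1, v>-1 and x ∈ ℝ_q^+. If the q-translation operator T_{q,x}^v is positive, then for every f ∈ L_{q,1,v} one has ∫_0^∞ |T_{q,x}^v f(y)| y^{2v+1} d_q y ≤ ‖f‖_{q,1,v}; in particular T_{q,x}^v f ∈ L_{q,1,v}. -/
open scoped BigOperators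

noncomputable section

namespace HahnExton

open Filter Topology

lemma summable_uncurry_of_abs_le_mul {α β : Type*} {F : α → β → ℝ} {u : α → ℝ} {w : β → ℝ}
    (hu : Summable u) (hw : Summable w) (h : ∀ i j, |F i j| ≤ u i * w j) :
    Summable (Function.uncurry F) :=
  Summable.of_norm_bounded (summable_mul_of_summable_norm hu.norm hw.norm) fun ij => h ij.1 ij.2

lemma tsum_comm_of_abs_le_mul {α β : Type*} {F : α → β → ℝ} {u : α → ℝ} {w : β → ℝ}
    (hu : Summable u) (hw : Summable w) (h : ∀ i j, |F i j| ≤ u i * w j) :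
    ∑' i, ∑' j, F i j = ∑' j, ∑' i, F i j :=
  (summable_uncurry_of_abs_le_mul hu hw h).tsum_comm.symm

/-- The Euler coefficients `(-1)^k p^{k(k-1)/2} / (p;p)_k`. -/
def eulerCoeff (p : ℝ) (k : ℕ) : ℝ := ∏ i ∈ Finset.range k, (-(p ^ i) / (1 - p ^ (i + 1)))

/-- Euler's series for `(x;p)_∞`. -/
def eulerSum (p x : ℝ) : ℝ := ∑' k, eulerCoeff p k * x ^ k

/-- The series form of `(p^{m+1};p)_∞`. -/
def eulerTail (p : ℝ) (m : ℤ) : ℝ := eulerSum p (p ^ (m + 1))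

/-- The unnormalized Hahn–Exton function `(r;p)_∞ ₁φ₁(0;r;p,p^{n+1})` in its dual expansion. -/
def bessel (p r : ℝ) (n : ℤ) : ℝ := ∑' k : ℕ, eulerCoeff p k * r ^ k * eulerTail p (n + k)

section

variable {p r : ℝ}

lemma one_sub_pow_succ_pos (hp0 : 0 < p) (hp1 : p < 1) (k : ℕ) : 0 < 1 - p ^ (k + 1) :=
  sub_pos.2 (pow_lt_one₀ hp0.le hp1 k.succ_ne_zero)

lemma eulerCoeff_succ (hp0 : 0 < p) (hp1 : p < 1) (k : ℕ) :
    eulerCoeff p (k + 1) * (1 - p ^ (k + 1)) = -(p ^ k) * eulerCoeff p k := by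
  have := (one_sub_pow_succ_pos hp0 hp1 k).ne'
  rw [eulerCoeff, Finset.prod_range_succ, ← eulerCoeff]
  field_simp

lemma eulerCoeff_zero : eulerCoeff p 0 = 1 := by simp [eulerCoeff]

lemma eulerCoeff_ne_zero (hp0 : 0 < p) (hp1 : p < 1) (k : ℕ) : eulerCoeff p k ≠ 0 :=
  Finset.prod_ne_zero_iff.2 fun i _ =>
    div_ne_zero (neg_ne_zero.2 (pow_pos hp0 i).ne') (one_sub_pow_succ_pos hp0 hp1 i).ne'

lemma summable_eulerCoeff (hp0 : 0 < p) (hp1 : p < 1) (x : ℝ) :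
    Summable fun k => |eulerCoeff p k| * |x| ^ k := by
  rcases eq_or_ne x 0 with rfl | hx
  · refine summable_of_ne_finset_zero (s := {0}) fun k hk => ?_
    have : k ≠ 0 := by simpa using hk
    simp [this]
  have hx' : 0 < |x| := abs_pos.2 hx
  refine summable_of_ratio_test_tendsto_lt_one zero_lt_one
    (.of_forall fun k => mul_ne_zero (abs_ne_zero.2 (eulerCoeff_ne_zero hp0 hp1 k))
      (pow_pos hx' k).ne') ?_
  have hlim : Tendsto (fun k : ℕ => p ^ k * |x| / (1 - p ^ (k + 1))) atTop (𝓝 (0 * |x| / (1 - 0))) :=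
    ((tendsto_pow_atTop_nhds_zero_of_lt_one hp0.le hp1).mul_const _).div
      (tendsto_const_nhds.sub
        ((tendsto_add_atTop_iff_nat 1).2 (tendsto_pow_atTop_nhds_zero_of_lt_one hp0.le hp1)))
      (by norm_num)
  simp only [zero_mul, zero_div] at hlim
  refine hlim.congr fun k => ?_
  have h1 := one_sub_pow_succ_pos hp0 hp1 k
  have h2 : |eulerCoeff p (k + 1)| * (1 - p ^ (k + 1)) = p ^ k * |eulerCoeff p k| := by
    have := congrArg abs (eulerCoeff_succ hp0 hp1 k)
    rwa [abs_mul, abs_mul, abs_neg, abs_of_pos h1, abs_of_pos (pow_pos hp0 k)] at this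
  have h3 : 0 < |eulerCoeff p k| := abs_pos.2 (eulerCoeff_ne_zero hp0 hp1 k)
  simp only [norm_mul, Real.norm_eq_abs, abs_abs, norm_pow]
  rw [div_eq_div_iff h1.ne' (mul_pos h3 (pow_pos hx' k)).ne']
  linear_combination (-(|x| ^ (k + 1))) * h2

lemma summable_eulerCoeff_mul_pow (hp0 : 0 < p) (hp1 : p < 1) (x : ℝ) :
    Summable fun k => eulerCoeff p k * x ^ k :=
  Summable.of_norm_bounded (summable_eulerCoeff hp0 hp1 x) fun k => by simp

lemma summable_abs_eulerCoeff (hp0 : 0 < p) (hp1 : p < 1) :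
    Summable fun k => |eulerCoeff p k| := by
  simpa using summable_eulerCoeff hp0 hp1 1

lemma eulerSum_eq (hp0 : 0 < p) (hp1 : p < 1) (x : ℝ) :
    eulerSum p x = (1 - x) * eulerSum p (p * x) := by
  have h1 := summable_eulerCoeff_mul_pow hp0 hp1 x
  have h2 := summable_eulerCoeff_mul_pow hp0 hp1 (p * x)
  have h : eulerSum p x - eulerSum p (p * x) = -x * eulerSum p (p * x) := by
    rw [eulerSum, eulerSum, ← h1.tsum_sub h2, (h1.sub h2).tsum_eq_zero_add, ← tsum_mul_left]
    simp only [pow_zero, sub_self, zero_add]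
    refine tsum_congr fun k => ?_
    linear_combination x ^ (k + 1) * eulerCoeff_succ hp0 hp1 k
  linarith

lemma eulerSum_one (hp0 : 0 < p) (hp1 : p < 1) : eulerSum p 1 = 0 := by
  rw [eulerSum_eq hp0 hp1]; simp

lemma eulerSum_eq_qPoch_mul (hp0 : 0 < p) (hp1 : p < 1) (x : ℝ) (n : ℕ) :
    eulerSum p x = qPoch x p n * eulerSum p (x * p ^ n) := by
  induction n with
  | zero => simp [qPoch]
  | succ n ih =>
    rw [ih, eulerSum_eq hp0 hp1 (x * p ^ n), qPoch, qPoch, Finset.prod_range_succ,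
      show p * (x * p ^ n) = x * p ^ (n + 1) by ring]
    ring

/-- A constant bounding Euler's series and its increment at the origin on the unit interval. -/
def eulerBound (p : ℝ) : ℝ := 1 + ∑' k, |eulerCoeff p k|

lemma one_le_eulerBound : 1 ≤ eulerBound p :=
  le_add_of_nonneg_right (tsum_nonneg fun _ => abs_nonneg _)

lemma abs_eulerSum_le (hp0 : 0 < p) (hp1 : p < 1) {x : ℝ} (hx0 : 0 ≤ x) (hx1 : x ≤ 1) :
    |eulerSum p x| ≤ eulerBound p := by
  have hs := summable_abs_eulerCoeff hp0 hp1
  rw [eulerSum, ← Real.norm_eq_abs]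
  refine (tsum_of_norm_bounded hs.hasSum fun k => ?_).trans
    (le_add_of_nonneg_left zero_le_one)
  rw [Real.norm_eq_abs, abs_mul, abs_of_nonneg (pow_nonneg hx0 k)]
  exact mul_le_of_le_one_right (abs_nonneg _) (pow_le_one₀ hx0 hx1)

lemma abs_eulerSum_sub_one_le (hp0 : 0 < p) (hp1 : p < 1) {x : ℝ} (hx0 : 0 ≤ x) (hx1 : x ≤ 1) :
    |eulerSum p x - 1| ≤ eulerBound p * x := by
  have hs := summable_abs_eulerCoeff hp0 hp1
  have hs1 := (summable_nat_add_iff 1).2 hs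
  have heq : eulerSum p x - 1 = ∑' k, eulerCoeff p (k + 1) * x ^ (k + 1) := by
    rw [eulerSum, (summable_eulerCoeff_mul_pow hp0 hp1 x).tsum_eq_zero_add]
    simp [eulerCoeff_zero]
  rw [heq, ← Real.norm_eq_abs]
  refine (tsum_of_norm_bounded (hs1.mul_right x).hasSum fun k => ?_).trans ?_
  · rw [Real.norm_eq_abs, abs_mul, abs_of_nonneg (pow_nonneg hx0 _)]
    gcongr
    exact pow_le_of_le_one hx0 hx1 k.succ_ne_zero
  · rw [tsum_mul_right]
    gcongr
    have := hs.tsum_eq_zero_add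
    have h0 := abs_nonneg (eulerCoeff p 0)
    rw [eulerBound]
    linarith

lemma tendsto_eulerSum (hp0 : 0 < p) (hp1 : p < 1) {x : ℝ} (hx0 : 0 ≤ x) (hx1 : x ≤ 1) :
    Tendsto (fun n : ℕ => eulerSum p (x * p ^ n)) atTop (𝓝 1) := by
  have hpow := (tendsto_pow_atTop_nhds_zero_of_lt_one hp0.le hp1).const_mul (eulerBound p * x)
  rw [mul_zero] at hpow
  rw [tendsto_iff_norm_sub_tendsto_zero]
  refine squeeze_zero (fun _ => norm_nonneg _) (fun n => ?_) hpow
  have h0 : 0 ≤ x * p ^ n := by positivity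
  have h1 : x * p ^ n ≤ 1 := mul_le_one₀ hx1 (by positivity) (pow_le_one₀ hp0.le hp1.le)
  simpa [mul_assoc] using abs_eulerSum_sub_one_le hp0 hp1 h0 h1

lemma qPochInf_eq_eulerSum (hp0 : 0 < p) (hp1 : p < 1) {x : ℝ} (hx0 : 0 ≤ x) (hx1 : x ≤ 1) :
    qPochInf x p = eulerSum p x := by
  have hm : Multipliable fun i : ℕ => 1 - x * p ^ i := by
    have : Summable fun i : ℕ => ‖-(x * p ^ i)‖ := by
      simpa [abs_of_pos hp0] using (summable_geometric_of_lt_one hp0.le hp1).mul_left |x|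
    simpa [sub_eq_add_neg] using multipliable_one_add_of_summable this
  have h1 := (hm.hasProd.tendsto_prod_nat).mul (tendsto_eulerSum hp0 hp1 hx0 hx1)
  rw [mul_one] at h1
  refine tendsto_nhds_unique h1 (tendsto_const_nhds.congr fun n => ?_)
  exact eulerSum_eq_qPoch_mul hp0 hp1 x n

lemma qPoch_pos (hp0 : 0 < p) (hp1 : p < 1) {x : ℝ} (hx0 : 0 ≤ x) (hx1 : x < 1) (n : ℕ) :
    0 < qPoch x p n :=
  Finset.prod_pos fun _ _ => sub_pos.2 <|
    (mul_le_of_le_one_right hx0 (pow_le_one₀ hp0.le hp1.le)).trans_lt hx1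

lemma eulerSum_ne_zero (hp0 : 0 < p) (hp1 : p < 1) {x : ℝ} (hx0 : 0 ≤ x) (hx1 : x < 1) :
    eulerSum p x ≠ 0 := by
  obtain ⟨n, hn⟩ := ((tendsto_eulerSum hp0 hp1 hx0 hx1.le).eventually_ne one_ne_zero).exists
  rw [eulerSum_eq_qPoch_mul hp0 hp1 x n]
  exact mul_ne_zero (qPoch_pos hp0 hp1 hx0 hx1 n).ne' hn

lemma eulerTail_sub_one (hp0 : 0 < p) (hp1 : p < 1) (m : ℤ) :
    eulerTail p (m - 1) = (1 - p ^ m) * eulerTail p m := by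
  rw [eulerTail, eulerTail, sub_add_cancel, eulerSum_eq hp0 hp1, zpow_add_one₀ hp0.ne', mul_comm p]

lemma eulerTail_of_neg (hp0 : 0 < p) (hp1 : p < 1) {m : ℤ} (hm : m < 0) : eulerTail p m = 0 := by
  have h : ∀ n : ℕ, eulerTail p (-1 - n) = 0 := by
    intro n
    induction n with
    | zero => simp [eulerTail, eulerSum_one hp0 hp1]
    | succ n ih =>
      rw [show (-1 - ((n + 1 : ℕ) : ℤ)) = -1 - n - 1 by push_cast; ring,
        eulerTail_sub_one hp0 hp1, ih, mul_zero]
  have := h (-1 - m).toNat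
  rwa [Int.toNat_of_nonneg (by omega), sub_sub_cancel] at this

lemma abs_eulerTail_le (hp0 : 0 < p) (hp1 : p < 1) (m : ℤ) : |eulerTail p m| ≤ eulerBound p := by
  rcases lt_or_ge m 0 with hm | hm
  · rw [eulerTail_of_neg hp0 hp1 hm, abs_zero]
    exact zero_le_one.trans one_le_eulerBound
  · exact abs_eulerSum_le hp0 hp1 (zpow_nonneg hp0.le _) (zpow_le_one₀ hp0 hp1.le (by omega))

lemma abs_eulerTail_sub_one_le (hp0 : 0 < p) (hp1 : p < 1) (m : ℤ) :
    |eulerTail p m - 1| ≤ eulerBound p * p ^ m := by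
  have hB : 1 ≤ eulerBound p := one_le_eulerBound
  rcases lt_or_ge m 0 with hm | hm
  · rw [eulerTail_of_neg hp0 hp1 hm, zero_sub, abs_neg, abs_one]
    exact one_le_mul_of_one_le_of_one_le hB (one_le_zpow_of_nonpos₀ hp0 hp1.le hm.le)
  · refine (abs_eulerSum_sub_one_le hp0 hp1 (zpow_nonneg hp0.le _)
      (zpow_le_one₀ hp0 hp1.le (by omega))).trans ?_
    rw [zpow_add_one₀ hp0.ne']
    gcongr
    exact mul_le_of_le_one_right (zpow_nonneg hp0.le _) hp1.le

lemma summable_zpow_mul_eulerTail (hp0 : 0 < p) (hp1 : p < 1) {ρ : ℝ} (hρ0 : 0 < ρ) (hρ1 : ρ < 1) :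
    Summable fun m : ℤ => ρ ^ m * |eulerTail p m| := by
  refine Summable.of_nat_of_neg_add_one ?_ ?_
  · refine Summable.of_norm_bounded
      ((summable_geometric_of_lt_one hρ0.le hρ1).mul_right (eulerBound p)) fun n => ?_
    rw [zpow_natCast, norm_mul, Real.norm_eq_abs, Real.norm_eq_abs, abs_abs,
      abs_of_pos (pow_pos hρ0 n)]
    gcongr
    exact abs_eulerTail_le hp0 hp1 _
  · refine summable_zero.congr fun n => ?_
    rw [eulerTail_of_neg hp0 hp1 (by omega), abs_zero, mul_zero]

lemma tsum_eulerCoeff_mul_eulerTail (hp0 : 0 < p) (hp1 : p < 1) (N : ℤ) :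
    ∑' i : ℕ, eulerCoeff p i * eulerTail p (N - i) = if N = 0 then eulerSum p p else 0 := by
  have hbd : ∀ (M : ℤ) (i : ℕ), ‖eulerCoeff p i * eulerTail p (M - i)‖
      ≤ |eulerCoeff p i| * eulerBound p := fun M i => by
    rw [norm_mul, Real.norm_eq_abs, Real.norm_eq_abs]
    gcongr
    exact abs_eulerTail_le hp0 hp1 _
  have hs : ∀ M : ℤ, Summable fun i : ℕ => eulerCoeff p i * eulerTail p (M - i) := fun M =>
    Summable.of_norm_bounded ((summable_abs_eulerCoeff hp0 hp1).mul_right _) (hbd M)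
  split_ifs with hN
  · subst hN
    rw [tsum_eq_single 0 fun i hi => ?_]
    · simp [eulerCoeff_zero, eulerTail]
    · rw [eulerTail_of_neg hp0 hp1 (by omega), mul_zero]
  · have hs1 : Summable fun i : ℕ => p ^ i * (eulerCoeff p i * eulerTail p (N - 1 - i)) :=
      Summable.of_norm_bounded ((summable_abs_eulerCoeff hp0 hp1).mul_right _) fun i => by
        rw [norm_mul, Real.norm_of_nonneg (pow_nonneg hp0.le i)]
        exact (mul_le_of_le_one_left (norm_nonneg _) (pow_le_one₀ hp0.le hp1.le)).trans (hbd _ i)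
    have hs2 : Summable fun i : ℕ => (1 - p ^ i) * (eulerCoeff p i * eulerTail p (N - i)) :=
      Summable.of_norm_bounded ((summable_abs_eulerCoeff hp0 hp1).mul_right _) fun i => by
        have h1 : p ^ i ≤ 1 := pow_le_one₀ hp0.le hp1.le
        have h2 : 0 ≤ p ^ i := pow_nonneg hp0.le i
        rw [norm_mul, Real.norm_of_nonneg (by linarith)]
        exact (mul_le_of_le_one_left (norm_nonneg _) (by linarith)).trans (hbd _ i)
    have key : (1 - p ^ N) * ∑' i : ℕ, eulerCoeff p i * eulerTail p (N - i) = 0 := by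
      have hsplit : ∀ i : ℕ, (1 - p ^ N) * (eulerCoeff p i * eulerTail p (N - i)) =
          (1 - p ^ i) * (eulerCoeff p i * eulerTail p (N - i)) +
            p ^ i * (eulerCoeff p i * eulerTail p (N - 1 - i)) := fun i => by
        have h1 : p ^ N = p ^ i * p ^ (N - i) := by
          rw [← zpow_natCast, ← zpow_add₀ hp0.ne']; congr 1; ring
        rw [show N - 1 - (i : ℤ) = N - i - 1 by ring, eulerTail_sub_one hp0 hp1, h1]
        ring
      rw [← tsum_mul_left, tsum_congr hsplit, hs2.tsum_add hs1, hs2.tsum_eq_zero_add,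
        pow_zero, sub_self, zero_mul, zero_add,
        ← ((summable_nat_add_iff 1).2 hs2).tsum_add hs1]
      refine (tsum_congr fun i => ?_).trans tsum_zero
      rw [show N - ((i + 1 : ℕ) : ℤ) = N - 1 - i by push_cast; ring]
      linear_combination eulerTail p (N - 1 - i) * eulerCoeff_succ hp0 hp1 i
    refine (mul_eq_zero.1 key).resolve_left (sub_ne_zero.2 fun h => hN ?_)
    exact (zpow_eq_one_iff_right₀ hp0.le hp1.ne).1 h.symm

/-- The shear `(k, n) ↦ (k, n + k)` of `ℕ × ℤ`. -/
def shearEquiv : ℕ × ℤ ≃ ℕ × ℤ := Equiv.prodShear (Equiv.refl ℕ) fun k => Equiv.addRight (k : ℤ)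

lemma summable_shear {F : ℕ → ℤ → ℝ} (h : Summable (Function.uncurry F)) :
    Summable (Function.uncurry fun (k : ℕ) (n : ℤ) => F k (n + k)) :=
  shearEquiv.summable_iff.2 h

lemma tsum_shear {F : ℕ → ℤ → ℝ} (h : Summable (Function.uncurry F)) :
    ∑' n : ℤ, ∑' k : ℕ, F k (n + k) = ∑' k : ℕ, ∑' n : ℤ, F k n := by
  rw [(summable_shear h).tsum_comm]
  exact tsum_congr fun k => (Equiv.addRight (k : ℤ)).tsum_eq (F k)

lemma abs_bessel_term_le (hp0 : 0 < p) (hp1 : p < 1) (hr0 : 0 < r) (hr1 : r < 1) (k : ℕ) (m : ℤ) :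
    |eulerCoeff p k * r ^ k * eulerTail p m| ≤ |eulerCoeff p k| * eulerBound p := by
  rw [abs_mul, abs_mul, abs_of_pos (pow_pos hr0 k)]
  gcongr
  · exact mul_le_of_le_one_right (abs_nonneg _) (pow_le_one₀ hr0.le hr1.le)
  · exact abs_eulerTail_le hp0 hp1 m

lemma summable_bessel_term (hp0 : 0 < p) (hp1 : p < 1) (hr0 : 0 < r) (hr1 : r < 1) (n : ℤ) :
    Summable fun k : ℕ => eulerCoeff p k * r ^ k * eulerTail p (n + k) :=
  Summable.of_norm_bounded ((summable_abs_eulerCoeff hp0 hp1).mul_right _) fun k =>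
    abs_bessel_term_le hp0 hp1 hr0 hr1 k _

lemma abs_bessel_le (hp0 : 0 < p) (hp1 : p < 1) (hr0 : 0 < r) (hr1 : r < 1) (n : ℤ) :
    |bessel p r n| ≤ (∑' k, |eulerCoeff p k|) * eulerBound p := by
  rw [bessel, ← Real.norm_eq_abs, ← tsum_mul_right]
  exact tsum_of_norm_bounded ((summable_abs_eulerCoeff hp0 hp1).mul_right _).hasSum fun k =>
    abs_bessel_term_le hp0 hp1 hr0 hr1 k _

lemma summable_zpow_mul_abs_bessel (hp0 : 0 < p) (hp1 : p < 1) (hr0 : 0 < r) (hr1 : r < 1)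
    {ρ : ℝ} (hρ0 : 0 < ρ) (hρ1 : ρ < 1) : Summable fun n : ℤ => ρ ^ n * |bessel p r n| := by
  have h : Summable (Function.uncurry fun (k : ℕ) (m : ℤ) =>
      (|eulerCoeff p k| * |r / ρ| ^ k) * (ρ ^ m * |eulerTail p m|)) := by
    refine summable_uncurry_of_abs_le_mul (summable_eulerCoeff hp0 hp1 (r / ρ))
      (summable_zpow_mul_eulerTail hp0 hp1 hρ0 hρ1) fun k m => (abs_of_nonneg ?_).le
    positivity
  have h2 := (summable_shear h).prod_symm.prod
  refine Summable.of_norm_bounded h2 fun n => ?_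
  have hterm : ∀ k : ℕ, (|eulerCoeff p k| * |r / ρ| ^ k) * (ρ ^ (n + k) * |eulerTail p (n + k)|) =
      ρ ^ n * ‖eulerCoeff p k * r ^ k * eulerTail p (n + k)‖ := fun k => by
    rw [norm_mul, norm_mul, Real.norm_of_nonneg (pow_nonneg hr0.le k), abs_of_pos (div_pos hr0 hρ0),
      div_pow, zpow_add₀ hρ0.ne', zpow_natCast, Real.norm_eq_abs, Real.norm_eq_abs]
    field_simp
  have hn := norm_tsum_le_tsum_norm (summable_bessel_term hp0 hp1 hr0 hr1 n).norm
  rw [norm_mul, Real.norm_of_nonneg (zpow_nonneg hρ0.le n), norm_abs_eq_norm]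
  simp only [Prod.swap_prod_mk, Function.uncurry_apply_pair]
  rw [tsum_congr hterm, tsum_mul_left]
  exact mul_le_mul_of_nonneg_left hn (zpow_nonneg hρ0.le n)

lemma tsum_zpow_mul_bessel (hp0 : 0 < p) (hp1 : p < 1) (hr0 : 0 < r) (hr1 : r < 1) :
    ∑' n : ℤ, r ^ n * bessel p r n = 0 := by
  have h : Summable (Function.uncurry fun (k : ℕ) (m : ℤ) =>
      eulerCoeff p k * (r ^ m * eulerTail p m)) :=
    summable_uncurry_of_abs_le_mul (summable_abs_eulerCoeff hp0 hp1)
      (summable_zpow_mul_eulerTail hp0 hp1 hr0 hr1) fun k m => by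
        rw [abs_mul, abs_mul, abs_of_pos (zpow_pos hr0 m)]
  have hterm : ∀ n : ℤ, r ^ n * bessel p r n =
      ∑' k : ℕ, eulerCoeff p k * (r ^ (n + k) * eulerTail p (n + k)) := fun n => by
    rw [bessel, ← tsum_mul_left]
    refine tsum_congr fun k => ?_
    rw [zpow_add₀ hr0.ne', zpow_natCast]
    ring
  have h1 : ∑' k, eulerCoeff p k = 0 := by simpa [eulerSum] using eulerSum_one hp0 hp1
  rw [tsum_congr hterm, tsum_shear h]
  simp only [tsum_mul_left]
  rw [tsum_mul_right, h1, zero_mul]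

lemma abs_bessel_sub_le (hp0 : 0 < p) (hp1 : p < 1) (hr0 : 0 < r) (hr1 : r < 1) (n : ℤ) :
    |bessel p r n - eulerSum p r| ≤ (∑' k, |eulerCoeff p k|) * eulerBound p * p ^ n := by
  have hs := (summable_abs_eulerCoeff hp0 hp1).mul_right (eulerBound p * p ^ n)
  rw [bessel, eulerSum, ← (summable_bessel_term hp0 hp1 hr0 hr1 n).tsum_sub
    (summable_eulerCoeff_mul_pow hp0 hp1 r), ← Real.norm_eq_abs, mul_assoc, ← tsum_mul_right]
  refine tsum_of_norm_bounded hs.hasSum fun k => ?_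
  have hB : 0 ≤ eulerBound p := zero_le_one.trans one_le_eulerBound
  rw [← mul_sub_one, norm_mul, norm_mul, Real.norm_of_nonneg (pow_nonneg hr0.le k), mul_assoc]
  refine mul_le_mul_of_nonneg_left ?_ (norm_nonneg _)
  calc r ^ k * ‖eulerTail p (n + k) - 1‖ ≤ 1 * (eulerBound p * p ^ (n + k : ℤ)) := by
        gcongr
        · exact pow_le_one₀ hr0.le hr1.le
        · exact abs_eulerTail_sub_one_le hp0 hp1 _
    _ ≤ eulerBound p * p ^ n := by
        rw [one_mul, zpow_add₀ hp0.ne', zpow_natCast]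
        gcongr
        exact mul_le_of_le_one_right (zpow_nonneg hp0.le _) (pow_le_one₀ hp0.le hp1.le)

lemma tsum_eulerCoeff_mul_bessel (hp0 : 0 < p) (hp1 : p < 1) (hr0 : 0 < r) (hr1 : r < 1) (N : ℤ) :
    ∑' i : ℕ, eulerCoeff p i * bessel p r (N - i) =
      ∑' k : ℕ, if N + k = 0 then eulerCoeff p k * r ^ k * eulerSum p p else 0 := by
  have hs := summable_abs_eulerCoeff hp0 hp1
  simp only [bessel, ← tsum_mul_left]
  rw [tsum_comm_of_abs_le_mul hs (hs.mul_right (eulerBound p)) fun i k => ?_]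
  · refine tsum_congr fun k => ?_
    have hterm : ∀ i : ℕ, eulerCoeff p i * (eulerCoeff p k * r ^ k * eulerTail p (N - i + k)) =
        eulerCoeff p k * r ^ k * (eulerCoeff p i * eulerTail p (N + k - i)) := fun i => by
      rw [show N - (i : ℤ) + k = N + k - i by ring]; ring
    rw [tsum_congr hterm, tsum_mul_left, tsum_eulerCoeff_mul_eulerTail hp0 hp1, mul_ite, mul_zero]
  · rw [abs_mul]
    gcongr
    exact abs_bessel_term_le hp0 hp1 hr0 hr1 k _

lemma tsum_bessel_mul_bessel (hp0 : 0 < p) (hp1 : p < 1) (hr0 : 0 < r) (hr1 : r < 1) (l : ℤ) :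
    ∑' n : ℤ, r ^ n * bessel p r (n + l) * bessel p r n =
      if l = 0 then eulerSum p p ^ 2 else 0 := by
  set M := (∑' k, |eulerCoeff p k|) * eulerBound p with hM
  have hs := summable_abs_eulerCoeff hp0 hp1
  have ht := summable_zpow_mul_eulerTail hp0 hp1 hr0 hr1
  have hbound : ∀ (k : ℕ) (m : ℤ),
      |eulerCoeff p k * (r ^ m * eulerTail p m * bessel p r (m + l - k))| ≤
        |eulerCoeff p k| * (r ^ m * |eulerTail p m| * M) := fun k m => by
    rw [abs_mul, abs_mul, abs_mul, abs_of_pos (zpow_pos hr0 m)]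
    gcongr
    exact abs_bessel_le hp0 hp1 hr0 hr1 _
  have hterm : ∀ n : ℤ, r ^ n * bessel p r (n + l) * bessel p r n =
      ∑' k : ℕ, eulerCoeff p k *
        (r ^ (n + k) * eulerTail p (n + k) * bessel p r (n + k + l - k)) := fun n => by
    conv_lhs => rw [bessel.eq_def p r n, ← tsum_mul_left]
    refine tsum_congr fun k => ?_
    rw [zpow_add₀ hr0.ne', zpow_natCast, show n + (k : ℤ) + l - k = n + l by ring]
    ring
  rw [tsum_congr hterm, tsum_shear (F := fun k m => eulerCoeff p k *
    (r ^ m * eulerTail p m * bessel p r (m + l - k)))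
    (summable_uncurry_of_abs_le_mul hs (ht.mul_right M) hbound),
    tsum_comm_of_abs_le_mul hs (ht.mul_right M) hbound]
  have hterm2 : ∀ m : ℤ,
      ∑' k : ℕ, eulerCoeff p k * (r ^ m * eulerTail p m * bessel p r (m + l - k)) =
        ∑' k : ℕ, if m = -l - k then
          r ^ m * eulerTail p m * (eulerCoeff p k * r ^ k * eulerSum p p) else 0 := fun m => by
    have : ∀ k : ℕ, eulerCoeff p k * (r ^ m * eulerTail p m * bessel p r (m + l - k)) =
        r ^ m * eulerTail p m * (eulerCoeff p k * bessel p r (m + l - k)) := fun k => by ring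
    rw [tsum_congr this, tsum_mul_left, tsum_eulerCoeff_mul_bessel hp0 hp1 hr0 hr1,
      ← tsum_mul_left]
    refine tsum_congr fun k => ?_
    rw [mul_ite, mul_zero]
    exact if_congr (by omega) rfl rfl
  rw [tsum_congr hterm2, tsum_comm_of_abs_le_mul ht (hs.mul_right |eulerSum p p|) fun m k => ?_]
  · simp only [tsum_ite_eq]
    have hterm3 : ∀ k : ℕ, r ^ (-l - k : ℤ) * eulerTail p (-l - k) *
        (eulerCoeff p k * r ^ k * eulerSum p p) =
        r ^ (-l) * eulerSum p p * (eulerCoeff p k * eulerTail p (-l - k)) := fun k => by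
      have := (pow_pos hr0 k).ne'
      rw [zpow_sub₀ hr0.ne', zpow_natCast]
      field_simp
    rw [tsum_congr hterm3, tsum_mul_left, tsum_eulerCoeff_mul_eulerTail hp0 hp1]
    by_cases hl : l = 0
    · simp [hl, pow_two]
    · simp [hl]
  · split_ifs
    · rw [abs_mul, abs_mul, abs_mul, abs_mul, abs_of_pos (zpow_pos hr0 m),
        abs_of_pos (pow_pos hr0 k)]
      gcongr
      exact mul_le_of_le_one_right (abs_nonneg _) (pow_le_one₀ hr0.le hr1.le)
    · rw [abs_zero]
      have := zpow_nonneg hr0.le m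
      positivity

lemma eulerCoeff_mul_qPoch {q : ℝ} (hq0 : 0 < q) (hq1 : q < 1) (k : ℕ) :
    eulerCoeff (q ^ 2) k * (q ^ 2) ^ k * qPoch (q ^ 2) (q ^ 2) k =
      (-1) ^ k * q ^ (k * (k + 1)) := by
  have hp0 : 0 < q ^ 2 := by positivity
  have hp1 : q ^ 2 < 1 := pow_lt_one₀ hq0.le hq1 two_ne_zero
  induction k with
  | zero => simp [eulerCoeff, qPoch]
  | succ k ih =>
    have h := eulerCoeff_succ hp0 hp1 k
    have hP : qPoch (q ^ 2) (q ^ 2) (k + 1) =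
        qPoch (q ^ 2) (q ^ 2) k * (1 - (q ^ 2) ^ (k + 1)) := by
      rw [qPoch, Finset.prod_range_succ, ← qPoch, pow_succ' (q ^ 2)]
    rw [hP, show (k + 1) * (k + 1 + 1) = k * (k + 1) + 2 * (k + 1) by ring, pow_add q, pow_succ (-1 : ℝ)]
    rw [← pow_mul] at *
    linear_combination (q ^ (2 * (k + 1)) * qPoch (q ^ 2) (q ^ 2) k) * h - q ^ (2 * (k + 1)) * ih

lemma eulerSum_mul_jHE {q v : ℝ} (hq0 : 0 < q) (hq1 : q < 1) (hv : -1 < v) (n : ℤ) :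
    eulerSum (q ^ 2) (q ^ (2 * v + 2)) * jHE q v (q ^ n) = bessel (q ^ 2) (q ^ (2 * v + 2)) n := by
  have hp0 : 0 < q ^ 2 := by positivity
  have hp1 : q ^ 2 < 1 := pow_lt_one₀ hq0.le hq1 two_ne_zero
  have hr0 : 0 < q ^ (2 * v + 2) := Real.rpow_pos_of_pos hq0 _
  have hr1 : q ^ (2 * v + 2) < 1 := Real.rpow_lt_one hq0.le hq1 (by linarith)
  set p := q ^ 2 with hp
  set r := q ^ (2 * v + 2) with hr
  have hterm : ∀ k : ℕ, eulerSum p r * ((-1 : ℝ) ^ k * q ^ (k * (k + 1)) * (q ^ n) ^ (2 * k) /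
      (qPoch p p k * qPoch r p k)) =
      ∑' m : ℕ, eulerCoeff p m * r ^ m * (eulerCoeff p k * (p ^ (n + m + 1)) ^ k) := fun k => by
    have h1 := (qPoch_pos hp0 hp1 hp0.le hp1 k).ne'
    have h2 := (qPoch_pos hp0 hp1 hr0.le hr1 k).ne'
    have h3 : (q ^ n) ^ (2 * k) = (p ^ n) ^ k := by
      rw [pow_mul, hp, pow_two, pow_two, mul_zpow]
    rw [← eulerCoeff_mul_qPoch hq0 hq1, eulerSum_eq_qPoch_mul hp0 hp1 r k, ← hp, h3]
    have h4 : ∀ m : ℕ, eulerCoeff p m * r ^ m * (eulerCoeff p k * (p ^ (n + m + 1)) ^ k) =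
        eulerCoeff p k * p ^ k * (p ^ n) ^ k * (eulerCoeff p m * (r * p ^ k) ^ m) := fun m => by
      rw [zpow_add₀ hp0.ne', zpow_add₀ hp0.ne', zpow_natCast, zpow_one]
      ring
    rw [tsum_congr h4, tsum_mul_left, ← eulerSum]
    field_simp
  have hn := summable_eulerCoeff hp0 hp1 (p ^ (n + 1))
  rw [jHE, ← tsum_mul_left, tsum_congr hterm,
    tsum_comm_of_abs_le_mul hn (summable_abs_eulerCoeff hp0 hp1) fun k m => ?_, bessel]
  · refine tsum_congr fun m => ?_
    rw [tsum_mul_left, eulerTail, eulerSum]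
  · have hz : |p ^ (n + 1)| ^ k * p ^ (m * k) = (p ^ (n + m + 1)) ^ k := by
      rw [abs_of_pos (zpow_pos hp0 _), pow_mul, ← mul_pow, ← zpow_natCast p m, ← zpow_add₀ hp0.ne']
      congr 2; ring
    rw [abs_mul, abs_mul, abs_mul, ← hz, abs_of_pos (pow_pos hr0 m),
      abs_of_nonneg (mul_nonneg (by positivity) (pow_nonneg hp0.le _))]
    have h1 : r ^ m ≤ 1 := pow_le_one₀ hr0.le hr1.le
    have h2 : p ^ (m * k) ≤ 1 := pow_le_one₀ hp0.le hp1.le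
    calc |eulerCoeff p m| * r ^ m * (|eulerCoeff p k| * (|p ^ (n + 1)| ^ k * p ^ (m * k)))
        ≤ |eulerCoeff p m| * 1 * (|eulerCoeff p k| * (|p ^ (n + 1)| ^ k * 1)) := by gcongr
      _ = |eulerCoeff p k| * |p ^ (n + 1)| ^ k * |eulerCoeff p m| := by ring

end

section

variable {r p κ M C H A : ℝ} {ψ h : ℤ → ℝ}

lemma summable_zpow_mul_abs_shift (hr0 : 0 < r) (hs : Summable fun n : ℤ => r ^ n * |ψ n|) (l : ℤ) :
    Summable fun n : ℤ => r ^ n * |ψ (n + l)| := by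
  have h1 := (((Equiv.addRight l).summable_iff).2 hs).mul_left (r ^ (-l))
  refine h1.congr fun n => ?_
  simp only [Function.comp_apply, Equiv.coe_addRight]
  rw [← mul_assoc, ← zpow_add₀ hr0.ne', show -l + (n + l) = n by ring]

/-- The lattice transform `b ↦ ∑ₙ rⁿ h(n) ψ(n + b)`. -/
def latticeTransform (r : ℝ) (ψ h : ℤ → ℝ) (b : ℤ) : ℝ := ∑' n : ℤ, r ^ n * h n * ψ (n + b)

lemma abs_latticeTransform_le (hr0 : 0 < r) (hM : ∀ n, |ψ n| ≤ M)
    (hh : Summable fun n : ℤ => r ^ n * |h n|) (b : ℤ) :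
    |latticeTransform r ψ h b| ≤ (∑' n : ℤ, r ^ n * |h n|) * M := by
  rw [latticeTransform, ← tsum_mul_right, ← Real.norm_eq_abs]
  refine tsum_of_norm_bounded (hh.mul_right M).hasSum fun n => ?_
  rw [Real.norm_eq_abs, abs_mul, abs_mul, abs_of_pos (zpow_pos hr0 n)]
  have := zpow_pos hr0 n
  gcongr
  exact hM _

lemma zpow_mul_abs_latticeTransform_le (hr0 : 0 < r) (hp0 : 0 < p)
    (hH : ∀ n, |h n| ≤ H) (hC : ∀ n, |h n - κ| ≤ C * p ^ n)
    (hs : Summable fun n : ℤ => r ^ n * |ψ n|)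
    (hs' : Summable fun n : ℤ => (r * p) ^ n * |ψ n|)
    (hzero : ∑' n : ℤ, r ^ n * ψ n = 0) (b : ℤ) :
    r ^ b * |latticeTransform r ψ h b| ≤ C * (∑' n : ℤ, (r * p) ^ n * |ψ n|) * p ^ (-b) := by
  have hsum1 : Summable fun n : ℤ => r ^ n * h (n - b) * ψ n :=
    Summable.of_norm_bounded (hs.mul_left H) fun n => by
      rw [Real.norm_eq_abs, abs_mul, abs_mul, abs_of_pos (zpow_pos hr0 n)]
      have h1 := mul_le_mul_of_nonneg_left (hH (n - b))
        (mul_nonneg (zpow_pos hr0 n).le (abs_nonneg (ψ n)))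
      linarith
  have hsum2 : Summable fun n : ℤ => κ * (r ^ n * ψ n) :=
    (Summable.of_norm_bounded hs fun n => by
      rw [Real.norm_eq_abs, abs_mul, abs_of_pos (zpow_pos hr0 n)]).mul_left κ
  have heq : r ^ b * latticeTransform r ψ h b =
      ∑' n : ℤ, r ^ n * (h (n - b) - κ) * ψ n := by
    have h0 : r ^ b * latticeTransform r ψ h b = ∑' n : ℤ, r ^ n * h (n - b) * ψ n := by
      rw [latticeTransform, ← tsum_mul_left, ← (Equiv.addRight b).tsum_eq
        (fun n => r ^ n * h (n - b) * ψ n)]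
      refine tsum_congr fun n => ?_
      rw [Equiv.coe_addRight, add_sub_cancel_right, zpow_add₀ hr0.ne']
      ring
    rw [h0, ← sub_zero (∑' n : ℤ, r ^ n * h (n - b) * ψ n), ← mul_zero κ, ← hzero, ← tsum_mul_left,
      ← hsum1.tsum_sub hsum2]
    exact tsum_congr fun n => by ring
  rw [← abs_of_pos (zpow_pos hr0 b), ← abs_mul, heq,
    ← Real.norm_eq_abs, mul_right_comm, ← tsum_mul_left]
  refine tsum_of_norm_bounded (hs'.mul_left _).hasSum fun n => ?_
  rw [Real.norm_eq_abs, abs_mul, abs_mul, abs_of_pos (zpow_pos hr0 n)]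
  have h1 := mul_le_mul_of_nonneg_left (hC (n - b))
    (mul_nonneg (zpow_pos hr0 n).le (abs_nonneg (ψ n)))
  rw [mul_zpow]
  rw [sub_eq_add_neg n b, zpow_add₀ hp0.ne'] at h1
  rw [sub_eq_add_neg n b]
  linarith

lemma summable_zpow_mul_abs_latticeTransform (hr0 : 0 < r) (hr1 : r < 1) (hp0 : 0 < p)
    (hp1 : p < 1) (hM : ∀ n, |ψ n| ≤ M) (hH : ∀ n, |h n| ≤ H) (hC : ∀ n, |h n - κ| ≤ C * p ^ n)
    (hh : Summable fun n : ℤ => r ^ n * |h n|)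
    (hs : Summable fun n : ℤ => r ^ n * |ψ n|)
    (hs' : Summable fun n : ℤ => (r * p) ^ n * |ψ n|)
    (hzero : ∑' n : ℤ, r ^ n * ψ n = 0) :
    Summable fun b : ℤ => r ^ b * |latticeTransform r ψ h b| := by
  have hnn : ∀ b : ℤ, 0 ≤ r ^ b * |latticeTransform r ψ h b| := fun b =>
    mul_nonneg (zpow_pos hr0 b).le (abs_nonneg _)
  refine Summable.of_nat_of_neg_add_one ?_ ?_
  · refine Summable.of_nonneg_of_le (fun _ => hnn _) (fun n => ?_)
      ((summable_geometric_of_lt_one hr0.le hr1).mul_right ((∑' n : ℤ, r ^ n * |h n|) * M))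
    rw [zpow_natCast]
    gcongr
    exact abs_latticeTransform_le hr0 hM hh _
  · refine Summable.of_nonneg_of_le (fun _ => hnn _)
      (fun n => zpow_mul_abs_latticeTransform_le hr0 hp0 hH hC hs hs' hzero _) ?_
    refine Summable.mul_left _ ?_
    refine ((summable_nat_add_iff 1).2 (summable_geometric_of_lt_one hp0.le hp1)).congr fun n => ?_
    rw [neg_neg, ← zpow_natCast, Nat.cast_add, Nat.cast_one]

lemma tsum_latticeTransform_mul (hr0 : 0 < r) (hM : ∀ n, |ψ n| ≤ M)
    (hh : Summable fun n : ℤ => r ^ n * |h n|)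
    (hs : Summable fun n : ℤ => r ^ n * |ψ n|)
    (horth : ∀ l : ℤ, ∑' n : ℤ, r ^ n * ψ (n + l) * ψ n = if l = 0 then 1 else 0) (l : ℤ) :
    ∑' b : ℤ, r ^ b * latticeTransform r ψ h b * ψ (b + l) = h l := by
  have hterm : ∀ b : ℤ, r ^ b * latticeTransform r ψ h b * ψ (b + l) =
      ∑' n : ℤ, r ^ b * ψ (b + l) * (r ^ n * h n * ψ (n + b)) := fun b => by
    rw [tsum_mul_left, latticeTransform]; ring
  rw [tsum_congr hterm, tsum_comm_of_abs_le_mul (summable_zpow_mul_abs_shift hr0 hs l)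
    (hh.mul_right M) fun b n => ?_]
  · have hinner : ∀ n : ℤ, ∑' b : ℤ, r ^ b * ψ (b + l) * (r ^ n * h n * ψ (n + b)) =
        if n = l then h n else 0 := fun n => by
      have h1 : ∑' b : ℤ, r ^ b * ψ (b + l) * (r ^ n * h n * ψ (n + b)) =
          r ^ (n - l) * h n * ∑' b : ℤ, r ^ b * ψ (b + (n - l)) * ψ b := by
        rw [← tsum_mul_left, ← (Equiv.addRight l).tsum_eq
          (fun b => r ^ (n - l) * h n * (r ^ b * ψ (b + (n - l)) * ψ b))]
        refine tsum_congr fun b => ?_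
        have := (zpow_pos hr0 l).ne'
        rw [Equiv.coe_addRight, show b + l + (n - l) = n + b by ring, zpow_add₀ hr0.ne',
          zpow_sub₀ hr0.ne']
        field_simp
      rw [h1, horth]
      by_cases hn : n = l
      · simp [hn]
      · simp [hn, sub_eq_zero]
    rw [tsum_congr hinner, tsum_ite_eq]
  · have := zpow_pos hr0 b
    have := zpow_pos hr0 n
    rw [abs_mul, abs_mul, abs_mul, abs_mul, abs_of_pos (zpow_pos hr0 n),
      abs_of_pos (zpow_pos hr0 b)]
    gcongr
    exact hM _

lemma tendsto_natCast_shift (hp0 : 0 < p) (hp1 : p < 1) (hC : ∀ n, |h n - κ| ≤ C * p ^ n) (b : ℤ) :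
    Tendsto (fun l : ℕ => h (b + l)) atTop (𝓝 κ) := by
  have hlim := (tendsto_pow_atTop_nhds_zero_of_lt_one hp0.le hp1).const_mul (C * p ^ b)
  rw [mul_zero] at hlim
  rw [tendsto_iff_norm_sub_tendsto_zero]
  refine squeeze_zero (fun _ => norm_nonneg _) (fun l => (hC _).trans_eq ?_) hlim
  rw [zpow_add₀ hp0.ne', zpow_natCast, mul_assoc]

lemma tsum_latticeTransform (hr0 : 0 < r) (hr1 : r < 1) (hp0 : 0 < p) (hp1 : p < 1) (hκ : κ ≠ 0)
    (hM : ∀ n, |ψ n| ≤ M) (hA : ∀ n, |ψ n - κ| ≤ A * p ^ n)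
    (hH : ∀ n, |h n| ≤ H) (hC : ∀ n, |h n - κ| ≤ C * p ^ n)
    (hh : Summable fun n : ℤ => r ^ n * |h n|)
    (hs : Summable fun n : ℤ => r ^ n * |ψ n|)
    (hs' : Summable fun n : ℤ => (r * p) ^ n * |ψ n|)
    (hzero : ∑' n : ℤ, r ^ n * ψ n = 0)
    (horth : ∀ l : ℤ, ∑' n : ℤ, r ^ n * ψ (n + l) * ψ n = if l = 0 then 1 else 0) :
    ∑' b : ℤ, r ^ b * latticeTransform r ψ h b = 1 := by
  have hsum := summable_zpow_mul_abs_latticeTransform hr0 hr1 hp0 hp1 hM hH hC hh hs hs' hzero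
  have h1 : Tendsto (fun l : ℕ => ∑' b : ℤ, r ^ b * latticeTransform r ψ h b * ψ (b + l)) atTop
      (𝓝 (∑' b : ℤ, r ^ b * latticeTransform r ψ h b * κ)) := by
    refine tendsto_tsum_of_dominated_convergence (hsum.mul_right M)
      (fun b => (tendsto_natCast_shift hp0 hp1 hA b).const_mul _) (.of_forall fun l b => ?_)
    rw [norm_mul, norm_mul, Real.norm_of_nonneg (zpow_pos hr0 b).le]
    have := zpow_pos hr0 b
    exact mul_le_mul_of_nonneg_left (hM _) (by positivity)
  have h2 : Tendsto (fun l : ℕ => h l) atTop (𝓝 κ) := by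
    simpa using tendsto_natCast_shift hp0 hp1 hC 0
  simp only [tsum_latticeTransform_mul hr0 hM hh hs horth] at h1
  have h3 := tendsto_nhds_unique h1 h2
  rw [tsum_mul_right] at h3
  exact mul_right_cancel₀ hκ (h3.trans (one_mul κ).symm)

lemma markov_contraction {F T : ℤ → ℝ} {K : ℤ → ℤ → ℝ} (hr0 : 0 < r) (hK : ∀ m b, 0 ≤ K m b)
    (hKs : ∀ m, Summable fun b : ℤ => r ^ b * K m b) (hK1 : ∀ m, ∑' b : ℤ, r ^ b * K m b = 1)
    (hF : Summable fun m : ℤ => r ^ m * |F m|)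
    (hT : ∀ b, T b = ∑' m : ℤ, r ^ m * F m * K m b) :
    (Summable fun b : ℤ => r ^ b * |T b|) ∧
      ∑' b : ℤ, r ^ b * |T b| ≤ ∑' m : ℤ, r ^ m * |F m| := by
  obtain ⟨G, hGdef⟩ : ∃ G : ℤ → ℤ → ℝ, ∀ m b, G m b = r ^ m * |F m| * (r ^ b * K m b) :=
    ⟨_, fun _ _ => rfl⟩
  have hG0 : 0 ≤ Function.uncurry G := fun mb => by
    refine (?_ : 0 ≤ G mb.1 mb.2)
    rw [hGdef]
    exact mul_nonneg (mul_nonneg (zpow_pos hr0 _).le (abs_nonneg _))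
      (mul_nonneg (zpow_pos hr0 _).le (hK _ _))
  have hGb : ∀ m, ∑' b, G m b = r ^ m * |F m| := fun m => by
    simp only [hGdef]
    rw [tsum_mul_left, hK1, mul_one]
  have hG : Summable (Function.uncurry G) :=
    (summable_prod_of_nonneg hG0).2 ⟨fun m => ((hKs m).mul_left _).congr fun b => (hGdef m b).symm,
      hF.congr fun m => (hGb m).symm⟩
  have hle : ∀ b : ℤ, r ^ b * |T b| ≤ ∑' m, G m b := fun b => by
    have hterm : ∀ m, ‖r ^ b * (r ^ m * F m * K m b)‖ = G m b := fun m => by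
      rw [Real.norm_eq_abs, abs_mul, abs_mul, abs_mul, abs_of_pos (zpow_pos hr0 b),
        abs_of_pos (zpow_pos hr0 m), abs_of_nonneg (hK m b)]
      rw [hGdef]
      ring
    rw [← abs_of_pos (zpow_pos hr0 b), ← abs_mul, hT,
      ← tsum_mul_left, ← tsum_congr hterm]
    exact norm_tsum_le_tsum_norm ((hG.prod_symm.prod_factor b).congr fun m => (hterm m).symm)
  have hGs : Summable fun b => ∑' m, G m b := hG.prod_symm.prod
  have hsum := Summable.of_nonneg_of_le
    (fun b => mul_nonneg (zpow_pos hr0 b).le (abs_nonneg _)) hle hGs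
  refine ⟨hsum, (hsum.tsum_le_tsum hle hGs).trans_eq ?_⟩
  rw [hG.tsum_comm]
  exact tsum_congr hGb

end

/-- The Hahn–Exton function on the lattice, normalized so that it is orthonormal. -/
def orthoBessel (q v : ℝ) (n : ℤ) : ℝ :=
  bessel (q ^ 2) (q ^ (2 * v + 2)) n / eulerSum (q ^ 2) (q ^ 2)

/-- The limit of `orthoBessel` at the origin of the lattice. -/
def orthoLimit (q v : ℝ) : ℝ := eulerSum (q ^ 2) (q ^ (2 * v + 2)) / eulerSum (q ^ 2) (q ^ 2)

/-- The product of two Hahn–Exton functions of which the translation kernel is the transform. -/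
def translationSymbol (q v : ℝ) (a m n : ℤ) : ℝ :=
  (orthoLimit q v)⁻¹ * orthoBessel q v (n + m) * orthoBessel q v (n + a)

/-- The kernel of the q-translation operator on the lattice. -/
def translationKernel (q v : ℝ) (a m b : ℤ) : ℝ :=
  latticeTransform (q ^ (2 * v + 2)) (orthoBessel q v) (translationSymbol q v a m) b

section

variable {q v : ℝ}

lemma zpow_mul_zpow_rpow (hq0 : 0 < q) (n : ℤ) :
    q ^ n * (q ^ n) ^ (2 * v + 1) = (q ^ (2 * v + 2)) ^ n := by
  rw [← Real.rpow_intCast, ← Real.rpow_intCast, ← Real.rpow_mul hq0.le, ← Real.rpow_mul hq0.le,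
    ← Real.rpow_add hq0]
  ring_nf

lemma rpow_weight_lt_one (hq0 : 0 < q) (hq1 : q < 1) (hv : -1 < v) : q ^ (2 * v + 2) < 1 :=
  Real.rpow_lt_one hq0.le hq1 (by linarith)

lemma eulerSum_sq_ne_zero (hq0 : 0 < q) (hq1 : q < 1) : eulerSum (q ^ 2) (q ^ 2) ≠ 0 := by
  have hp1 : q ^ 2 < 1 := pow_lt_one₀ hq0.le hq1 two_ne_zero
  exact eulerSum_ne_zero (by positivity) hp1 (by positivity) hp1

lemma orthoLimit_ne_zero (hq0 : 0 < q) (hq1 : q < 1) (hv : -1 < v) : orthoLimit q v ≠ 0 :=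
  div_ne_zero (eulerSum_ne_zero (by positivity) (pow_lt_one₀ hq0.le hq1 two_ne_zero)
    (Real.rpow_nonneg hq0.le _) (rpow_weight_lt_one hq0 hq1 hv)) (eulerSum_sq_ne_zero hq0 hq1)

lemma cqv_mul_one_sub (hq0 : 0 < q) (hq1 : q < 1) (hv : -1 < v) :
    cqv q v * (1 - q) = orthoLimit q v := by
  have hp1 : q ^ 2 < 1 := pow_lt_one₀ hq0.le hq1 two_ne_zero
  have hq : 1 - q ≠ 0 := (sub_pos.2 hq1).ne'
  rw [cqv, qPochInf_eq_eulerSum (by positivity) hp1 (Real.rpow_nonneg hq0.le _)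
    (rpow_weight_lt_one hq0 hq1 hv).le, qPochInf_eq_eulerSum (by positivity) hp1 (by positivity)
    hp1.le, orthoLimit]
  field_simp

lemma jHE_zpow (hq0 : 0 < q) (hq1 : q < 1) (hv : -1 < v) (n : ℤ) :
    jHE q v (q ^ n) = (orthoLimit q v)⁻¹ * orthoBessel q v n := by
  have h1 : eulerSum (q ^ 2) (q ^ (2 * v + 2)) ≠ 0 :=
    eulerSum_ne_zero (by positivity) (pow_lt_one₀ hq0.le hq1 two_ne_zero)
      (Real.rpow_nonneg hq0.le _) (rpow_weight_lt_one hq0 hq1 hv)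
  have h2 := eulerSum_sq_ne_zero hq0 hq1
  rw [orthoBessel, ← eulerSum_mul_jHE hq0 hq1 hv, orthoLimit]
  generalize eulerSum (q ^ 2) (q ^ (2 * v + 2)) = g at h1
  field_simp

lemma exists_abs_orthoBessel_le (hq0 : 0 < q) (hq1 : q < 1) (hv : -1 < v) :
    ∃ M, ∀ n, |orthoBessel q v n| ≤ M := by
  refine ⟨(∑' k, |eulerCoeff (q ^ 2) k|) * eulerBound (q ^ 2) / |eulerSum (q ^ 2) (q ^ 2)|,
    fun n => ?_⟩
  rw [orthoBessel, abs_div]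
  exact div_le_div_of_nonneg_right (abs_bessel_le (by positivity)
    (pow_lt_one₀ hq0.le hq1 two_ne_zero) (Real.rpow_pos_of_pos hq0 _)
    (rpow_weight_lt_one hq0 hq1 hv) n) (abs_nonneg _)

lemma exists_abs_orthoBessel_sub_le (hq0 : 0 < q) (hq1 : q < 1) (hv : -1 < v) :
    ∃ C, ∀ n, |orthoBessel q v n - orthoLimit q v| ≤ C * (q ^ 2) ^ n := by
  refine ⟨(∑' k, |eulerCoeff (q ^ 2) k|) * eulerBound (q ^ 2) / |eulerSum (q ^ 2) (q ^ 2)|,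
    fun n => ?_⟩
  rw [orthoBessel, orthoLimit, ← sub_div, abs_div, div_mul_eq_mul_div]
  exact div_le_div_of_nonneg_right (abs_bessel_sub_le (by positivity)
    (pow_lt_one₀ hq0.le hq1 two_ne_zero) (Real.rpow_pos_of_pos hq0 _)
    (rpow_weight_lt_one hq0 hq1 hv) n) (abs_nonneg _)

lemma summable_zpow_mul_abs_orthoBessel (hq0 : 0 < q) (hq1 : q < 1) (hv : -1 < v) {ρ : ℝ}
    (hρ0 : 0 < ρ) (hρ1 : ρ < 1) : Summable fun n : ℤ => ρ ^ n * |orthoBessel q v n| := by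
  refine ((summable_zpow_mul_abs_bessel (by positivity) (pow_lt_one₀ hq0.le hq1 two_ne_zero)
    (Real.rpow_pos_of_pos hq0 _) (rpow_weight_lt_one hq0 hq1 hv) hρ0 hρ1).div_const
    |eulerSum (q ^ 2) (q ^ 2)|).congr fun n => ?_
  rw [orthoBessel, abs_div, mul_div_assoc]

lemma tsum_zpow_mul_orthoBessel (hq0 : 0 < q) (hq1 : q < 1) (hv : -1 < v) :
    ∑' n : ℤ, (q ^ (2 * v + 2)) ^ n * orthoBessel q v n = 0 := by
  simp only [orthoBessel, ← mul_div_assoc]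
  rw [tsum_div_const, tsum_zpow_mul_bessel (by positivity) (pow_lt_one₀ hq0.le hq1 two_ne_zero)
    (Real.rpow_pos_of_pos hq0 _) (rpow_weight_lt_one hq0 hq1 hv), zero_div]

lemma tsum_orthoBessel_mul_orthoBessel (hq0 : 0 < q) (hq1 : q < 1) (hv : -1 < v) (l : ℤ) :
    ∑' n : ℤ, (q ^ (2 * v + 2)) ^ n * orthoBessel q v (n + l) * orthoBessel q v n =
      if l = 0 then 1 else 0 := by
  have h := eulerSum_sq_ne_zero hq0 hq1
  simp only [orthoBessel, ← mul_div_assoc, div_mul_eq_mul_div, div_div]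
  rw [tsum_div_const, tsum_bessel_mul_bessel (by positivity) (pow_lt_one₀ hq0.le hq1 two_ne_zero)
    (Real.rpow_pos_of_pos hq0 _) (rpow_weight_lt_one hq0 hq1 hv), ite_div, zero_div, pow_two,
    div_self (mul_ne_zero h h)]

lemma exists_abs_translationSymbol_le (hq0 : 0 < q) (hq1 : q < 1) (hv : -1 < v) (a m : ℤ) :
    ∃ H, ∀ n, |translationSymbol q v a m n| ≤ H := by
  obtain ⟨M, hM⟩ := exists_abs_orthoBessel_le hq0 hq1 hv
  have hM0 : 0 ≤ M := (abs_nonneg _).trans (hM 0)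
  refine ⟨|(orthoLimit q v)⁻¹| * M * M, fun n => ?_⟩
  rw [translationSymbol, abs_mul, abs_mul]
  gcongr
  exacts [hM _, hM _]

lemma exists_abs_translationSymbol_sub_le (hq0 : 0 < q) (hq1 : q < 1) (hv : -1 < v) (a m : ℤ) :
    ∃ C, ∀ n, |translationSymbol q v a m n - orthoLimit q v| ≤ C * (q ^ 2) ^ n := by
  obtain ⟨M, hM⟩ := exists_abs_orthoBessel_le hq0 hq1 hv
  obtain ⟨C, hC⟩ := exists_abs_orthoBessel_sub_le hq0 hq1 hv
  have hM0 : 0 ≤ M := (abs_nonneg _).trans (hM 0)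
  have hκ := orthoLimit_ne_zero hq0 hq1 hv
  have hp0 : q ^ 2 ≠ 0 := by positivity
  set κ := orthoLimit q v with hκ_eq
  refine ⟨|κ⁻¹| * (C * (q ^ 2) ^ m * M + |κ| * (C * (q ^ 2) ^ a)), fun n => ?_⟩
  have heq : translationSymbol q v a m n - κ = κ⁻¹ *
      ((orthoBessel q v (n + m) - κ) * orthoBessel q v (n + a) +
        κ * (orthoBessel q v (n + a) - κ)) := by
    rw [translationSymbol, ← hκ_eq]
    field_simp
    ring
  have h1 := hC (n + m)
  have h2 := hC (n + a)
  rw [heq, abs_mul, mul_assoc]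
  refine mul_le_mul_of_nonneg_left ((abs_add_le _ _).trans ?_) (abs_nonneg _)
  rw [abs_mul, abs_mul]
  calc _ ≤ C * (q ^ 2) ^ (n + m) * M + |κ| * (C * (q ^ 2) ^ (n + a)) := by
        gcongr
        · exact (abs_nonneg _).trans h1
        · exact hM _
    _ = _ := by rw [zpow_add₀ hp0, zpow_add₀ hp0]; ring

lemma summable_zpow_mul_abs_translationSymbol (hq0 : 0 < q) (hq1 : q < 1) (hv : -1 < v)
    (a m : ℤ) : Summable fun n : ℤ => (q ^ (2 * v + 2)) ^ n * |translationSymbol q v a m n| := by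
  obtain ⟨M, hM⟩ := exists_abs_orthoBessel_le hq0 hq1 hv
  have hr0 : 0 < q ^ (2 * v + 2) := Real.rpow_pos_of_pos hq0 _
  have hs := summable_zpow_mul_abs_shift hr0
    (summable_zpow_mul_abs_orthoBessel hq0 hq1 hv hr0 (rpow_weight_lt_one hq0 hq1 hv)) a
  refine Summable.of_nonneg_of_le (fun n => ?_) (fun n => ?_)
    (hs.mul_left (|(orthoLimit q v)⁻¹| * M))
  · exact mul_nonneg (zpow_pos hr0 n).le (abs_nonneg _)
  · rw [translationSymbol, abs_mul, abs_mul]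
    have := zpow_pos hr0 n
    calc _ ≤ (q ^ (2 * v + 2)) ^ n * (|(orthoLimit q v)⁻¹| * M * |orthoBessel q v (n + a)|) := by
          gcongr
          exact hM _
      _ = _ := by ring

lemma summable_zpow_mul_abs_translationKernel (hq0 : 0 < q) (hq1 : q < 1) (hv : -1 < v)
    (a m : ℤ) : Summable fun b : ℤ => (q ^ (2 * v + 2)) ^ b * |translationKernel q v a m b| := by
  obtain ⟨M, hM⟩ := exists_abs_orthoBessel_le hq0 hq1 hv
  obtain ⟨H, hH⟩ := exists_abs_translationSymbol_le hq0 hq1 hv a m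
  obtain ⟨C, hC⟩ := exists_abs_translationSymbol_sub_le hq0 hq1 hv a m
  have hr0 : 0 < q ^ (2 * v + 2) := Real.rpow_pos_of_pos hq0 _
  have hr1 := rpow_weight_lt_one hq0 hq1 hv
  have hp0 : 0 < q ^ 2 := by positivity
  have hp1 : q ^ 2 < 1 := pow_lt_one₀ hq0.le hq1 two_ne_zero
  exact summable_zpow_mul_abs_latticeTransform hr0 hr1 hp0 hp1 hM hH hC
    (summable_zpow_mul_abs_translationSymbol hq0 hq1 hv a m)
    (summable_zpow_mul_abs_orthoBessel hq0 hq1 hv hr0 hr1)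
    (summable_zpow_mul_abs_orthoBessel hq0 hq1 hv (mul_pos hr0 hp0)
      (mul_lt_one_of_nonneg_of_lt_one_left hr0.le hr1 hp1.le))
    (tsum_zpow_mul_orthoBessel hq0 hq1 hv)

lemma tsum_translationKernel (hq0 : 0 < q) (hq1 : q < 1) (hv : -1 < v) (a m : ℤ) :
    ∑' b : ℤ, (q ^ (2 * v + 2)) ^ b * translationKernel q v a m b = 1 := by
  obtain ⟨M, hM⟩ := exists_abs_orthoBessel_le hq0 hq1 hv
  obtain ⟨A, hA⟩ := exists_abs_orthoBessel_sub_le hq0 hq1 hv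
  obtain ⟨H, hH⟩ := exists_abs_translationSymbol_le hq0 hq1 hv a m
  obtain ⟨C, hC⟩ := exists_abs_translationSymbol_sub_le hq0 hq1 hv a m
  have hr0 : 0 < q ^ (2 * v + 2) := Real.rpow_pos_of_pos hq0 _
  have hr1 := rpow_weight_lt_one hq0 hq1 hv
  have hp0 : 0 < q ^ 2 := by positivity
  have hp1 : q ^ 2 < 1 := pow_lt_one₀ hq0.le hq1 two_ne_zero
  exact tsum_latticeTransform hr0 hr1 hp0 hp1 (orthoLimit_ne_zero hq0 hq1 hv) hM hA hH hC
    (summable_zpow_mul_abs_translationSymbol hq0 hq1 hv a m)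
    (summable_zpow_mul_abs_orthoBessel hq0 hq1 hv hr0 hr1)
    (summable_zpow_mul_abs_orthoBessel hq0 hq1 hv (mul_pos hr0 hp0)
      (mul_lt_one_of_nonneg_of_lt_one_left hr0.le hr1 hp1.le))
    (tsum_zpow_mul_orthoBessel hq0 hq1 hv) (tsum_orthoBessel_mul_orthoBessel hq0 hq1 hv)

lemma memL1_iff (hq0 : 0 < q) (f : ℝ → ℝ) :
    memL1 q v f ↔ Summable fun n : ℤ => (q ^ (2 * v + 2)) ^ n * |f (q ^ n)| := by
  refine summable_congr fun n => ?_
  rw [← zpow_mul_zpow_rpow hq0]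
  ring

lemma jackson_mul_rpow (hq0 : 0 < q) (g : ℝ → ℝ) :
    jackson q (fun y => g y * y ^ (2 * v + 1)) =
      (1 - q) * ∑' n : ℤ, (q ^ (2 * v + 2)) ^ n * g (q ^ n) := by
  rw [jackson]
  congr 1
  refine tsum_congr fun n => ?_
  rw [← zpow_mul_zpow_rpow hq0]
  ring

lemma qFourier_zpow (hq0 : 0 < q) (hq1 : q < 1) (hv : -1 < v) (f : ℝ → ℝ) (n : ℤ) :
    qFourier q v f (q ^ n) =
      ∑' m : ℤ, (q ^ (2 * v + 2)) ^ m * f (q ^ m) * orthoBessel q v (n + m) := by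
  have hκ := orthoLimit_ne_zero hq0 hq1 hv
  rw [qFourier, jackson_mul_rpow hq0 (fun t => f t * jHE q v (q ^ n * t)), ← mul_assoc,
    cqv_mul_one_sub hq0 hq1 hv, ← tsum_mul_left]
  refine tsum_congr fun m => ?_
  rw [← zpow_add₀ hq0.ne', jHE_zpow hq0 hq1 hv]
  field_simp

lemma qTrans_zpow (hq0 : 0 < q) (hq1 : q < 1) (hv : -1 < v) {f : ℝ → ℝ} (hf : memL1 q v f)
    (a b : ℤ) :
    qTrans q v (q ^ a) f (q ^ b) =
      ∑' m : ℤ, (q ^ (2 * v + 2)) ^ m * f (q ^ m) * translationKernel q v a m b := by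
  have hκ := orthoLimit_ne_zero hq0 hq1 hv
  have hr0 : 0 < q ^ (2 * v + 2) := Real.rpow_pos_of_pos hq0 _
  have hr1 := rpow_weight_lt_one hq0 hq1 hv
  obtain ⟨M, hM⟩ := exists_abs_orthoBessel_le hq0 hq1 hv
  rw [memL1_iff hq0] at hf
  have hs := summable_zpow_mul_abs_shift hr0
    (summable_zpow_mul_abs_orthoBessel hq0 hq1 hv hr0 hr1) a
  rw [qTrans, jackson_mul_rpow hq0
    (fun t => qFourier q v f t * jHE q v (q ^ a * t) * jHE q v (q ^ b * t)), ← mul_assoc,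
    cqv_mul_one_sub hq0 hq1 hv, ← tsum_mul_left]
  set r := q ^ (2 * v + 2)
  set κ := orthoLimit q v with hκ_eq
  have hterm : ∀ n : ℤ, κ * (r ^ n * (qFourier q v f (q ^ n) * jHE q v (q ^ a * q ^ n) *
      jHE q v (q ^ b * q ^ n))) = ∑' m : ℤ, r ^ m * f (q ^ m) *
        (r ^ n * translationSymbol q v a m n * orthoBessel q v (n + b)) := fun n => by
    have h1 : ∀ m : ℤ, r ^ m * f (q ^ m) *
        (r ^ n * translationSymbol q v a m n * orthoBessel q v (n + b)) =
        κ⁻¹ * r ^ n * orthoBessel q v (n + a) * orthoBessel q v (n + b) *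
          (r ^ m * f (q ^ m) * orthoBessel q v (n + m)) := fun m => by
      rw [translationSymbol, ← hκ_eq]; ring
    rw [tsum_congr h1, tsum_mul_left, ← qFourier_zpow hq0 hq1 hv, ← zpow_add₀ hq0.ne',
      ← zpow_add₀ hq0.ne', jHE_zpow hq0 hq1 hv, jHE_zpow hq0 hq1 hv, add_comm a, add_comm b, ← hκ_eq]
    field_simp
  rw [tsum_congr hterm, tsum_comm_of_abs_le_mul (hs.mul_left (|κ⁻¹| * M * M)) hf fun n m => ?_]
  · refine tsum_congr fun m => ?_
    rw [tsum_mul_left, translationKernel, latticeTransform]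
  · have h1 := zpow_pos hr0 n
    have h2 := zpow_pos hr0 m
    have hM0 : 0 ≤ M := (abs_nonneg _).trans (hM 0)
    rw [translationSymbol, abs_mul, abs_mul, abs_mul, abs_mul, abs_mul, abs_mul, abs_of_pos h1,
      abs_of_pos h2]
    calc _ ≤ r ^ m * |f (q ^ m)| * (r ^ n * (|κ⁻¹| * M * |orthoBessel q v (n + a)|) * M) := by
          gcongr
          exacts [hM _, hM _]
      _ = _ := by ring

lemma translationKernel_nonneg (hq0 : 0 < q) (hq1 : q < 1) (hv : -1 < v) {a : ℤ}
    (hpos : IsPosT q v (q ^ a)) (m b : ℤ) : 0 ≤ translationKernel q v a m b := by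
  have hr0 : 0 < q ^ (2 * v + 2) := Real.rpow_pos_of_pos hq0 _
  have hval : ∀ n : ℤ, Set.indicator {q ^ m} (1 : ℝ → ℝ) (q ^ n) = if n = m then 1 else 0 :=
    fun n => by
      simp only [Set.indicator_apply, Set.mem_singleton_iff, Pi.one_apply,
        zpow_right_inj₀ hq0 hq1.ne]
  have hf : memL1 q v (Set.indicator {q ^ m} 1) := by
    rw [memL1_iff hq0]
    refine summable_of_ne_finset_zero (s := {m}) fun n hn => ?_
    rw [hval, if_neg (by simpa using hn), abs_zero, mul_zero]
  have h := hpos _ hf (fun y _ => Set.indicator_nonneg (fun _ _ => zero_le_one) y) (q ^ b) ⟨b, rfl⟩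
  rw [qTrans_zpow hq0 hq1 hv hf, tsum_eq_single m fun n hn => by rw [hval, if_neg hn]; ring, hval,
    if_pos rfl, mul_one] at h
  exact nonneg_of_mul_nonneg_right h (zpow_pos hr0 m)

lemma summable_qTrans_and_tsum_le (hq0 : 0 < q) (hq1 : q < 1) (hv : -1 < v) {a : ℤ}
    (hpos : IsPosT q v (q ^ a)) {f : ℝ → ℝ} (hf : memL1 q v f) :
    (Summable fun b : ℤ => (q ^ (2 * v + 2)) ^ b * |qTrans q v (q ^ a) f (q ^ b)|) ∧
      ∑' b : ℤ, (q ^ (2 * v + 2)) ^ b * |qTrans q v (q ^ a) f (q ^ b)| ≤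
        ∑' m : ℤ, (q ^ (2 * v + 2)) ^ m * |f (q ^ m)| := by
  have hK := translationKernel_nonneg hq0 hq1 hv hpos
  refine markov_contraction (Real.rpow_pos_of_pos hq0 _) hK (fun m => ?_)
    (tsum_translationKernel hq0 hq1 hv a) ((memL1_iff hq0 f).1 hf) (qTrans_zpow hq0 hq1 hv hf a)
  exact (summable_zpow_mul_abs_translationKernel hq0 hq1 hv a m).congr fun b => by
    rw [abs_of_nonneg (hK m b)]

end

end HahnExton

/-- a positive q-translation operator is an `L_{q,1,v}` contraction. -/
theorem stmt8 (q v x : ℝ) (hq0 : 0 < q) (hq1 : q < 1) (hv : -1 < v)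
    (hx : x ∈ Rq q) (hpos : IsPosT q v x)
    (f : ℝ → ℝ) (hf : memL1 q v f) :
    jackson q (fun y => |qTrans q v x f y| * y ^ (2 * v + 1 : ℝ)) ≤
        jackson q (fun y => |f y| * y ^ (2 * v + 1 : ℝ)) ∧
      memL1 q v (qTrans q v x f) := by
  obtain ⟨a, rfl⟩ := hx
  obtain ⟨hsum, hle⟩ := HahnExton.summable_qTrans_and_tsum_le hq0 hq1 hv hpos hf
  refine ⟨?_, (HahnExton.memL1_iff hq0 _).2 hsum⟩
  rw [HahnExton.jackson_mul_rpow hq0 (fun y => |qTrans q v (q ^ a) f y|),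
    HahnExton.jackson_mul_rpow hq0 (fun y => |f y|)]
  exact mul_le_mul_of_nonneg_left hle (sub_pos.2 hq1).le
end
end
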